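/- arXiv:math/9201250 — 5 statements merged into one kernel-verified Lean document; each statement's English description precedes it below -/
import Mathlib

section
/- For every infinite Boolean algebra B, the cardinality of the set of automorphisms of B is at most the cardinality of the set of subalgebras of B. -/
/-- A (Boolean) subalgebra of `B`, as a subset. -/
def IsSubalg {B : Type*} [BooleanAlgebra B] (S : Set B) : Prop :=
  ⊥ ∈ S ∧ ⊤ ∈ S ∧ (∀ x ∈ S, ∀ y ∈ S, x ⊔ y ∈ S) ∧
    (∀ x ∈ S, ∀ y ∈ S, x ⊓ y ∈ S) ∧ (∀ x ∈ S, xᶜ ∈ S)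

section Subalgebras

variable {B : Type*} [BooleanAlgebra B]

theorem IsSubalg.of_sup_compl {S : Set B} (hbot : ⊥ ∈ S)
    (hsup : ∀ x ∈ S, ∀ y ∈ S, x ⊔ y ∈ S) (hcompl : ∀ x ∈ S, xᶜ ∈ S) : IsSubalg S := by
  refine ⟨hbot, by simpa using hcompl _ hbot, hsup, fun x hx y hy => ?_, hcompl⟩
  simpa using hcompl _ (hsup _ (hcompl x hx) _ (hcompl y hy))

/-- The subalgebra generated by an ideal: its elements and their complements. -/
def idealSubalg (I : Order.Ideal B) : {S : Set B // IsSubalg S} :=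
  ⟨{x | x ∈ I ∨ xᶜ ∈ I}, by
    refine .of_sup_compl (Or.inl I.bot_mem) ?_ ?_
    · rintro x (hx | hx) y (hy | hy)
      · exact Or.inl (I.sup_mem hx hy)
      · exact Or.inr (I.lower (compl_le_compl le_sup_right) hy)
      · exact Or.inr (I.lower (compl_le_compl le_sup_left) hx)
      · exact Or.inr (I.lower (compl_le_compl le_sup_left) hx)
    · rintro x (hx | hx)
      · exact Or.inr (by simpa using hx)
      · exact Or.inl hx⟩

theorem le_of_idealSubalg_eq {I J : Order.Ideal B} {c : B} (hc : c ≠ ⊤)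
    (hI : ∀ x ∈ I, x ≤ c) (hJ : ∀ x ∈ J, x ≤ c) (h : idealSubalg I = idealSubalg J) :
    I ≤ J := by
  intro a ha
  have haJ : a ∈ (idealSubalg J).1 := h ▸ Or.inl ha
  rcases haJ with haJ | haJ
  · exact haJ
  · refine absurd (top_le_iff.1 ?_) hc
    rw [← sup_compl_eq_top (x := a)]
    exact sup_le (hI a ha) (hJ _ haJ)

theorem inf_principal_eq_of_idealSubalg_eq {I J : Order.Ideal B} {c : B} (hc : c ≠ ⊤)
    (h : idealSubalg (I ⊓ .principal c) = idealSubalg (J ⊓ .principal c)) :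
    I ⊓ .principal c = J ⊓ .principal c :=
  le_antisymm
    (le_of_idealSubalg_eq hc (fun _ hx => hx.2) (fun _ hx => hx.2) h)
    (le_of_idealSubalg_eq hc (fun _ hx => hx.2) (fun _ hx => hx.2) h.symm)

theorem exists_injective_ideal_subalg {c : B} (hbot : c ≠ ⊥) (htop : c ≠ ⊤) :
    Function.Injective fun I : Order.Ideal B =>
      (idealSubalg (I ⊓ .principal c), idealSubalg (I ⊓ .principal cᶜ)) := by
  suffices key : ∀ I J : Order.Ideal B, I ⊓ .principal c = J ⊓ .principal c →
      I ⊓ .principal cᶜ = J ⊓ .principal cᶜ → I ≤ J by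
    intro I J h
    have h₁ := inf_principal_eq_of_idealSubalg_eq htop (Prod.ext_iff.1 h).1
    have h₂ := inf_principal_eq_of_idealSubalg_eq (by simpa using hbot) (Prod.ext_iff.1 h).2
    exact le_antisymm (key I J h₁ h₂) (key J I h₁.symm h₂.symm)
  intro I J h₁ h₂ a ha
  have m₁ : a ⊓ c ∈ J ⊓ Order.Ideal.principal c :=
    h₁ ▸ ⟨I.lower inf_le_left ha, inf_le_right (a := a)⟩
  have m₂ : a ⊓ cᶜ ∈ J ⊓ Order.Ideal.principal cᶜ :=
    h₂ ▸ ⟨I.lower inf_le_left ha, inf_le_right (a := a)⟩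
  have := J.sup_mem m₁.1 m₂.1
  rwa [← inf_sup_left, sup_compl_eq_top, inf_top_eq] at this

theorem infinite_subalg_and_mk_ideal_le [Infinite B] :
    Infinite {S : Set B // IsSubalg S} ∧
      Cardinal.mk (Order.Ideal B) ≤ Cardinal.mk {S : Set B // IsSubalg S} := by
  obtain ⟨c, hc⟩ := (Set.toFinite {(⊥ : B), ⊤}).exists_notMem
  obtain ⟨hbot, htop⟩ : c ≠ ⊥ ∧ c ≠ ⊤ := by simpa using hc
  have hinj := exists_injective_ideal_subalg hbot htop
  have hprin : Function.Injective (Order.Ideal.principal : B → Order.Ideal B) := fun x y h =>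
    le_antisymm (Order.Ideal.principal_le_iff.1 h.le) (Order.Ideal.principal_le_iff.1 h.ge)
  have hinf : Infinite {S : Set B // IsSubalg S} := by
    by_contra hfin
    rw [not_infinite_iff_finite] at hfin
    exact not_finite_iff_infinite.2 ‹Infinite B› (Finite.of_injective _ (hinj.comp hprin))
  refine ⟨hinf, (Cardinal.mk_le_of_injective hinj).trans ?_⟩
  rw [Cardinal.mk_prod, Cardinal.lift_id,
    Cardinal.mul_eq_self (Cardinal.aleph0_le_mk _)]

end Subalgebras

section Automorphisms

variable {B : Type*} [BooleanAlgebra B]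

/-- The automorphism `f` carries elements of `S` to elements disjoint from those of `S`. -/
def IsDisplaced (f : B ≃o B) (S : Set B) : Prop := ∀ a ∈ S, ∀ b ∈ S, f a ⊓ b = ⊥

/-- The elements `b` with `x ∈ b ↔ f x ∈ b` for each point `x` of the open set given by `S`. -/
def localFixedSubalg (f : B ≃o B) (S : Set B) : {S : Set B // IsSubalg S} :=
  ⟨{b | ∀ v ∈ S, f (b ⊓ v) = b ⊓ f v}, by
    refine .of_sup_compl (by simp) (fun x hx y hy v hv => ?_) (fun x hx v hv => ?_)
    · rw [inf_sup_right, map_sup, hx v hv, hy v hv, inf_sup_right]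
    · have h := hx v hv
      rw [map_inf] at h ⊢
      rw [map_compl', inf_comm, inf_comm xᶜ, ← sdiff_eq, ← sdiff_eq, ← sdiff_inf_self_right,
        h, sdiff_inf_self_right]⟩

theorem eqOn_of_localFixedSubalg_eq {f g : B ≃o B} {S : Set B} (hf : IsDisplaced f S)
    (hg : IsDisplaced g S)
    (h : localFixedSubalg f S = localFixedSubalg g S) : Set.EqOn f g S := by
  suffices key : ∀ f g : B ≃o B, IsDisplaced f S → IsDisplaced g S →
      localFixedSubalg f S = localFixedSubalg g S → ∀ w ∈ S, g w ≤ f w from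
    fun w hw => le_antisymm (key g f hg hf h.symm w hw) (key f g hf hg h w hw)
  intro f g hf hg h w hw
  have hmem : w ⊔ f w ∈ (localFixedSubalg f S).1 := by
    intro v hv
    have h₁ := hf w hw v hv
    have h₂ := hf v hv w hw
    rw [inf_sup_right, inf_sup_right, h₁, sup_bot_eq, map_inf, inf_comm w, h₂, bot_sup_eq]
  rw [h] at hmem
  have h₁ := hmem w hw
  rw [inf_comm, inf_sup_self, inf_sup_right, inf_comm w, hg w hw w hw,
    bot_sup_eq] at h₁
  exact inf_eq_right.1 h₁.symm

theorem exists_maximal_isDisplaced (f : B ≃o B) : ∃ S : Set B, Maximal (IsDisplaced f) S := by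
  refine zorn_subset {S | IsDisplaced f S} fun c hc hchain =>
    ⟨⋃₀ c, ?_, fun s hs => Set.subset_sUnion_of_mem hs⟩
  rintro a ⟨s, hs, ha⟩ b ⟨t, ht, hb⟩
  rcases hchain.total hs ht with hst | hst
  · exact hc ht a (hst ha) b hb
  · exact hc hs a ha b (hst hb)

theorem Maximal.mem_of_isDisplaced {f : B ≃o B} {S : Set B} (hS : Maximal (IsDisplaced f) S)
    {w : B} (hw : f w ⊓ w = ⊥) (h₁ : ∀ v ∈ S, f w ⊓ v = ⊥) (h₂ : ∀ v ∈ S, f v ⊓ w = ⊥) :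
    w ∈ S := by
  refine hS.2 (y := insert w S) ?_ (Set.subset_insert w S) (Set.mem_insert w S)
  rintro a (rfl | ha) b (rfl | hb)
  exacts [hw, h₁ b hb, h₂ a ha, hS.1 a ha b hb]

theorem Maximal.isIdeal_of_isDisplaced {f : B ≃o B} {S : Set B}
    (hS : Maximal (IsDisplaced f) S) : Order.IsIdeal S where
  IsLowerSet a b hba ha := by
    have hle : f b ≤ f a := f.monotone hba
    refine hS.mem_of_isDisplaced (le_bot_iff.1 ?_) (fun v hv => le_bot_iff.1 ?_)
      fun v hv => le_bot_iff.1 ?_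
    · exact (inf_le_inf hle hba).trans (hS.1 a ha a ha).le
    · exact (inf_le_inf_right v hle).trans (hS.1 a ha v hv).le
    · exact (inf_le_inf_left (f v) hba).trans (hS.1 v hv a ha).le
  Nonempty := ⟨⊥, hS.mem_of_isDisplaced (by simp) (by simp) (by simp)⟩
  Directed a ha b hb := by
    have key : ∀ x ∈ S, ∀ y ∈ S, f x ⊓ y = ⊥ := hS.1
    refine ⟨a ⊔ b, hS.mem_of_isDisplaced ?_ (fun v hv => ?_) (fun v hv => ?_),
      le_sup_left, le_sup_right⟩
    · simp only [map_sup, inf_sup_left, inf_sup_right, key a ha a ha, key a ha b hb,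
        key b hb a ha, key b hb b hb, sup_bot_eq]
    · simp only [map_sup, inf_sup_right, key a ha v hv, key b hb v hv, sup_bot_eq]
    · simp only [inf_sup_left, key v hv a ha, key v hv b hb, sup_bot_eq]

theorem Order.IsIdeal.preimage_orderIso {S : Set B} (hS : Order.IsIdeal S) (f : B ≃o B) :
    Order.IsIdeal (f ⁻¹' S) where
  IsLowerSet := hS.IsLowerSet.preimage f.monotone
  Nonempty := hS.Nonempty.preimage f.surjective
  Directed a ha b hb := by
    obtain ⟨c, hc, hac, hbc⟩ := hS.Directed _ ha _ hb
    exact ⟨f.symm c, by simpa using hc, f.le_symm_apply.2 hac, f.le_symm_apply.2 hbc⟩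

theorem IsDisplaced.preimage {f : B ≃o B} {S : Set B} (hS : IsDisplaced f S) :
    IsDisplaced f (f ⁻¹' S) := fun a ha b hb =>
  f.injective (by simpa using hS _ ha _ hb)

theorem IsDisplaced.preimage_symm {f : B ≃o B} {S : Set B} (hS : IsDisplaced f S) :
    IsDisplaced f (f.symm ⁻¹' S) := fun a ha b hb =>
  f.symm.injective (by simpa using hS _ ha _ hb)

theorem exists_disjoint_apply_of_apply_ne {f : B ≃o B} {b : B} (h : f b ≠ b) :
    ∃ c ≤ b, c ≠ ⊥ ∧ f c ⊓ c = ⊥ := by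
  by_cases hle : b ≤ f b
  · refine ⟨b \ f.symm b, sdiff_le, fun h0 => ?_, ?_⟩
    · exact h (le_antisymm (f.le_symm_apply.1 (sdiff_eq_bot_iff.1 h0)) hle)
    · rw [map_sdiff', f.apply_symm_apply]
      exact (disjoint_sdiff_self_left.mono_right sdiff_le).eq_bot
  · refine ⟨b \ f b, sdiff_le, fun h0 => hle (sdiff_eq_bot_iff.1 h0), le_bot_iff.1 ?_⟩
    calc f (b \ f b) ⊓ (b \ f b) ≤ f b ⊓ (b \ f b) := inf_le_inf_right _ (f.monotone sdiff_le)
      _ = ⊥ := inf_sdiff_self_right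

theorem Maximal.apply_eq_of_isDisplaced {f : B ≃o B} {S : Set B} (hS : Maximal (IsDisplaced f) S)
    {c : B} (h₀ : ∀ v ∈ S, v ⊓ c = ⊥) (h₁ : ∀ v ∈ f ⁻¹' S, v ⊓ c = ⊥)
    (h₂ : ∀ v ∈ f.symm ⁻¹' S, v ⊓ c = ⊥) : f c = c := by
  by_contra hne
  obtain ⟨w, hwc, hw0, hw⟩ := exists_disjoint_apply_of_apply_ne hne
  have mono : ∀ {v}, v ⊓ c = ⊥ → v ⊓ w = ⊥ := fun hv =>
    le_bot_iff.1 ((inf_le_inf_left _ hwc).trans hv.le)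
  have hwS : w ∈ S := by
    refine hS.mem_of_isDisplaced hw (fun v hv => ?_) fun v hv => mono (h₂ _ (by simpa using hv))
    have := mono (h₁ (f.symm v) (by simpa using hv))
    simpa [inf_comm] using congrArg f this
  exact hw0 (by simpa using mono (h₀ w hwS))

theorem eq_of_eqOn_of_maximal_isDisplaced {f g : B ≃o B} {S : Set B}
    (hf : Maximal (IsDisplaced f) S) (hg : Maximal (IsDisplaced g) S)
    (hpre : f ⁻¹' S = g ⁻¹' S) (himg : f.symm ⁻¹' S = g.symm ⁻¹' S)
    (h₀ : Set.EqOn f g S) (h₁ : Set.EqOn f g (f ⁻¹' S))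
    (h₂ : Set.EqOn f g (f.symm ⁻¹' S)) : f = g := by
  by_contra hne
  obtain ⟨b, hb⟩ : ∃ b, f b ≠ g b := by simpa [DFunLike.ext_iff] using hne
  obtain ⟨c, -, hc0, hc⟩ := exists_disjoint_apply_of_apply_ne (f := f.trans g.symm) (b := b)
    (fun h => hb (by simpa [OrderIso.symm_apply_eq] using h))
  have disj : ∀ T : Set B, IsLowerSet T → Set.EqOn f g T → ∀ v ∈ T, v ⊓ c = ⊥ := by
    intro T hT hfg v hv
    have hfix : f.trans g.symm (v ⊓ c) = v ⊓ c := by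
      simp [-map_inf, hfg (hT inf_le_left hv)]
    refine le_bot_iff.1 (le_trans (le_inf ?_ inf_le_right) hc.le)
    rw [← hfix]
    exact (f.trans g.symm).monotone inf_le_right
  have hI := hf.isIdeal_of_isDisplaced
  have d₀ := disj S hI.IsLowerSet h₀
  have d₁ := disj _ (hI.preimage_orderIso f).IsLowerSet h₁
  have d₂ := disj _ (hI.preimage_orderIso f.symm).IsLowerSet h₂
  have hfc := hf.apply_eq_of_isDisplaced d₀ d₁ d₂
  have hgc := hg.apply_eq_of_isDisplaced d₀ (hpre ▸ d₁) (himg ▸ d₂)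
  have : f.trans g.symm c = c := by simp [hfc, OrderIso.symm_apply_eq, hgc]
  rw [this, inf_idem] at hc
  exact hc0 hc

theorem mk_orderIso_le_pow :
    Cardinal.mk (B ≃o B) ≤
      (Cardinal.mk (Order.Ideal B) * Cardinal.mk {S : Set B // IsSubalg S}) ^ 3 := by
  choose S hS using exists_maximal_isDisplaced (B := B)
  let T : (B ≃o B) → Fin 3 → Set B := fun f => ![S f, f ⁻¹' S f, f.symm ⁻¹' S f]
  have hideal : ∀ f i, Order.IsIdeal (T f i) := by
    intro f i
    have hI := (hS f).isIdeal_of_isDisplaced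
    fin_cases i
    exacts [hI, hI.preimage_orderIso f, hI.preimage_orderIso f.symm]
  have hdisp : ∀ f i, IsDisplaced f (T f i) := by
    intro f i
    fin_cases i
    exacts [(hS f).1, (hS f).1.preimage, (hS f).1.preimage_symm]
  let code : (B ≃o B) → Fin 3 → Order.Ideal B × {S : Set B // IsSubalg S} := fun f i =>
    ((hideal f i).toIdeal, localFixedSubalg f (T f i))
  have hcode : Function.Injective code := by
    intro f g h
    have hT : ∀ i, T f i = T g i := fun i =>
      congrArg (fun p : Order.Ideal B × _ => (p.1 : Set B)) (congrFun h i)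
    have heq : ∀ i, Set.EqOn f g (T f i) := fun i =>
      eqOn_of_localFixedSubalg_eq (hdisp f i) (hT i ▸ hdisp g i)
        ((congrArg Prod.snd (congrFun h i)).trans (by rw [hT i]))
    have hS₀ : S f = S g := hT 0
    have hpre : f ⁻¹' S f = g ⁻¹' S g := hT 1
    have himg : f.symm ⁻¹' S f = g.symm ⁻¹' S g := hT 2
    exact eq_of_eqOn_of_maximal_isDisplaced (hS f) (hS₀ ▸ hS g) (hS₀ ▸ hpre) (hS₀ ▸ himg)
      (heq 0) (heq 1) (heq 2)
  refine (Cardinal.mk_le_of_injective hcode).trans ?_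
  rw [← Cardinal.power_natCast]
  simp

end Automorphisms

/-- For an infinite Boolean algebra, the number of automorphisms is at most
the number of subalgebras. -/
theorem stmt_4 {B : Type*} [BooleanAlgebra B] [Infinite B] :
    Cardinal.mk (B ≃o B) ≤ Cardinal.mk {S : Set B // IsSubalg S} := by
  obtain ⟨_, hideal⟩ := infinite_subalg_and_mk_ideal_le (B := B)
  have hinf := Cardinal.aleph0_le_mk {S : Set B // IsSubalg S}
  calc Cardinal.mk (B ≃o B)
      ≤ (Cardinal.mk (Order.Ideal B) * Cardinal.mk {S : Set B // IsSubalg S}) ^ 3 :=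
        mk_orderIso_le_pow
    _ ≤ Cardinal.mk {S : Set B // IsSubalg S} ^ 3 := by
        gcongr
        exact Cardinal.mul_le_of_le hinf hideal le_rfl
    _ ≤ Cardinal.mk {S : Set B // IsSubalg S} := Cardinal.power_nat_le hinf
end

section
/- For every infinite Boolean algebra B, the cardinality of the set of endomorphisms of B is at most the cardinality of the set of subalgebras of B. -/
/-- A Boolean algebra endomorphism of `B`. -/
def IsBoolHom {B : Type*} [BooleanAlgebra B] (f : B → B) : Prop :=
  f ⊥ = ⊥ ∧ f ⊤ = ⊤ ∧ (∀ x y : B, f (x ⊔ y) = f x ⊔ f y) ∧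
    (∀ x y : B, f (x ⊓ y) = f x ⊓ f y) ∧ (∀ x : B, f xᶜ = (f x)ᶜ)

open Cardinal

universe u

namespace BooleanSubalgebra

variable {B : Type u} [BooleanAlgebra B]

theorem finite_closure {s : Set B} (hs : s.Finite) : (closure s : Set B).Finite := by
  set L := latticeClosure (insert ⊥ (insert ⊤ s))
  have hL : L.Finite := ((hs.insert ⊤).insert ⊥).latticeClosure
  have := hL.to_subtype
  have hbot : ⊥ ∈ L := subset_latticeClosure (by simp)
  have htop : ⊤ ∈ L := subset_latticeClosure (by simp)
  have hsL : s ⊆ L := fun x hx ↦ subset_latticeClosure (by simp [hx])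
  refine (Set.finite_range fun t : Finset (L × L) ↦ t.sup fun x ↦ x.1.1 \ x.2.1).subset ?_
  intro a ha
  obtain ⟨t, rfl⟩ := (mem_closure_iff_sup_sdiff isSublattice_latticeClosure hbot htop).1
    (closure_mono hsL ha)
  exact ⟨t, rfl⟩

theorem exists_finset_mem_closure {s : Set B} {x : B} (hx : x ∈ closure s) :
    ∃ t : Finset B, ↑t ⊆ s ∧ x ∈ closure (t : Set B) := by
  classical
  induction hx using closure_bot_sup_induction with
  | mem x hx => exact ⟨{x}, by simpa using hx, subset_closure (by simp)⟩
  | bot => exact ⟨∅, by simp, bot_mem⟩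
  | sup x hx y hy ihx ihy =>
    obtain ⟨t, ht, hxt⟩ := ihx
    obtain ⟨t', ht', hyt⟩ := ihy
    refine ⟨t ∪ t', by simp [ht, ht'], sup_mem (closure_mono ?_ hxt) (closure_mono ?_ hyt)⟩ <;>
      simp
  | compl x hx ih =>
    obtain ⟨t, ht, hxt⟩ := ih
    exact ⟨t, ht, compl_mem hxt⟩

theorem mk_closure_le {s : Set B} (hs : s.Infinite) : #(closure s) ≤ #s := by
  classical
  have := hs.to_subtype
  have hsub : (closure s : Set B) ⊆
      ⋃ t : Finset s, (closure (Subtype.val '' (t : Set s)) : Set B) := by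
    intro x hx
    obtain ⟨t, ht, hxt⟩ := exists_finset_mem_closure hx
    refine Set.mem_iUnion.2 ⟨t.subtype (· ∈ s), closure_mono ?_ hxt⟩
    intro y hy
    exact ⟨⟨y, ht hy⟩, by simpa using hy, rfl⟩
  calc #(closure s) ≤ _ := mk_le_mk_of_subset hsub
    _ ≤ #(Finset s) * ⨆ t : Finset s, #(closure (Subtype.val '' (t : Set s)) : Set B) :=
      mk_iUnion_le _
    _ ≤ #s * ℵ₀ := by
      rw [mk_finset_of_infinite]
      gcongr
      refine ciSup_le' fun t ↦ ?_
      exact (lt_aleph0_iff_set_finite.2 (finite_closure (t.finite_toSet.image _))).le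
    _ = #s := mul_aleph0_eq (aleph0_le_mk s)

/-- A set of elements of a Boolean algebra is irredundant if none of them lies in the subalgebra
generated by the others. -/
def Irredundant (X : Set B) : Prop :=
  ∀ x ∈ X, x ∉ closure (X \ {x})

theorem Irredundant.mk_set_le {X : Set B} (hX : Irredundant X) :
    #(Set X) ≤ #(BooleanSubalgebra B) := by
  have key : ∀ S T : Set X, closure (Subtype.val '' S) ≤ closure (Subtype.val '' T) → S ⊆ T := by
    intro S T h x hx
    by_contra hxT
    refine hX x x.2 (closure_mono ?_ (h (subset_closure ⟨x, hx, rfl⟩)))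
    rintro _ ⟨y, hy, rfl⟩
    exact ⟨y.2, fun hyx ↦ hxT (Subtype.ext hyx ▸ hy)⟩
  refine mk_le_of_injective (f := fun S : Set X ↦ closure (Subtype.val '' S)) fun S T h ↦ ?_
  exact (key S T h.le).antisymm (key T S h.ge)

theorem exists_symmDiff_le_of_mem_closure_insert {s : Set B} {a x : B}
    (hx : x ∈ closure (insert a s)) : ∃ v ∈ closure s, symmDiff x v ≤ a := by
  induction hx using closure_bot_sup_induction with
  | mem x hx =>
    rcases hx with rfl | hx
    · exact ⟨⊥, bot_mem, by simp⟩
    · exact ⟨x, subset_closure hx, by simp⟩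
  | bot => exact ⟨⊥, bot_mem, by simp⟩
  | sup x hx y hy ihx ihy =>
    obtain ⟨v, hv, hxv⟩ := ihx
    obtain ⟨w, hw, hyw⟩ := ihy
    refine ⟨v ⊔ w, sup_mem hv hw, ?_⟩
    rw [symmDiff_le_iff] at *
    constructor
    · exact sup_le (hxv.1.trans (by gcongr; exact le_sup_left))
        (hyw.1.trans (by gcongr; exact le_sup_right))
    · exact sup_le (hxv.2.trans (by gcongr; exact le_sup_left))
        (hyw.2.trans (by gcongr; exact le_sup_right))
  | compl x hx ih =>
    obtain ⟨v, hv, hxv⟩ := ih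
    exact ⟨vᶜ, compl_mem hv, by rwa [compl_symmDiff_compl]⟩

theorem Irredundant.insert {X : Set B} (hX : Irredundant X) {a : B} (ha : a ≠ ⊥)
    (h : ∀ d ∈ closure X, d ≤ a → d = ⊥) : Irredundant (insert a X) := by
  have haX : a ∉ closure X := fun haX ↦ ha (h a haX le_rfl)
  rintro x (rfl | hx) hmem
  · exact haX (closure_mono (by simp) hmem)
  · have hxa : x ≠ a := by rintro rfl; exact haX (subset_closure hx)
    rw [Set.insert_sdiff_of_notMem _ (by simpa using hxa.symm)] at hmem
    obtain ⟨v, hv, hle⟩ := exists_symmDiff_le_of_mem_closure_insert hmem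
    have hvX : v ∈ closure X := closure_mono Set.sdiff_subset hv
    have hxX : x ∈ closure X := subset_closure hx
    have hxv : x = v := symmDiff_eq_bot.1 <|
      h _ (sup_mem (sdiff_mem hxX hvX) (sdiff_mem hvX hxX)) hle
    exact hX x hx (hxv ▸ hv)

/-- A maximal irredundant subset of `C` generates a dense subalgebra of `C`. -/
theorem exists_irredundant_dense (C : BooleanSubalgebra B) :
    ∃ X : Set B, X ⊆ C ∧ Irredundant X ∧
      ∀ c ∈ C, c ≠ ⊥ → ∃ d ∈ closure X, d ≤ c ∧ d ≠ ⊥ := by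
  obtain ⟨X, hX⟩ := zorn_subset {X : Set B | X ⊆ C ∧ Irredundant X} fun c hc hchain ↦ by
    refine ⟨⋃₀ c, ⟨Set.sUnion_subset fun Y hY ↦ (hc hY).1, ?_⟩, fun Y ↦ Set.subset_sUnion_of_mem⟩
    rintro x ⟨Y, hY, hxY⟩ hx
    obtain ⟨t, ht, hxt⟩ := exists_finset_mem_closure hx
    obtain ⟨Z, hZ, htZ⟩ := hchain.directedOn.exists_mem_subset_of_finite_of_subset_sUnion
      ⟨Y, hY⟩ (t.finite_toSet.insert x)
      (Set.insert_subset ⟨Y, hY, hxY⟩ (ht.trans Set.sdiff_subset))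
    rw [Set.insert_subset_iff] at htZ
    exact (hc hZ).2 x htZ.1 (closure_mono (Set.subset_sdiff_singleton htZ.2 fun h ↦ (ht h).2 rfl) hxt)
  refine ⟨X, hX.prop.1, hX.prop.2, fun c hc hc0 ↦ ?_⟩
  by_contra! h
  have hins := hX.prop.2.insert hc0 h
  have hcX : c ∈ X := hX.2 (y := insert c X) ⟨Set.insert_subset hc hX.prop.1, hins⟩
    (Set.subset_insert c X) (Set.mem_insert c X)
  exact hc0 (h c (subset_closure hcX) le_rfl)

theorem aleph0_le_mk [Infinite B] : ℵ₀ ≤ #(BooleanSubalgebra B) := by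
  rw [← infinite_iff]
  by_contra h
  rw [not_infinite_iff_finite] at h
  have hfin (L : Set.range fun b : B ↦ closure {b}) : (L.1 : Set B).Finite := by
    obtain ⟨_, b, rfl⟩ := L
    exact finite_closure (Set.finite_singleton b)
  exact Set.infinite_univ (α := B) <| (Set.finite_iUnion hfin).subset fun b _ ↦
    Set.mem_iUnion.2 ⟨⟨_, b, rfl⟩, subset_closure rfl⟩

theorem exists_dense_mk_set_prod_le [Infinite B] (C : BooleanSubalgebra B) :
    ∃ D ≤ C, (∀ c ∈ C, c ≠ ⊥ → ∃ d ∈ D, d ≤ c ∧ d ≠ ⊥) ∧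
      #(Set (D × D)) ≤ #(BooleanSubalgebra B) := by
  obtain ⟨X, hXC, hX, hdense⟩ := exists_irredundant_dense C
  refine ⟨closure X, closure_le.2 hXC, hdense, ?_⟩
  rcases X.finite_or_infinite with hfin | hinf
  · have : Finite (closure X) := finite_closure hfin
    exact (lt_aleph0_of_finite _).le.trans aleph0_le_mk
  · have := hinf.to_subtype
    refine le_trans ?_ hX.mk_set_le
    simp only [mk_set, mk_prod, lift_id]
    refine power_le_power_left two_ne_zero ?_
    calc #(closure X) * #(closure X) ≤ #X * #X := by gcongr <;> exact mk_closure_le hinf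
      _ = #X := mul_eq_self (Cardinal.aleph0_le_mk X)

/-- The subalgebra generated by the elements of the kernel of `f` lying below `a`. -/
def kerBelow (f : BoundedLatticeHom B B) (a : B) : BooleanSubalgebra B where
  carrier := {x | (x ≤ a ∧ f x = ⊥) ∨ (xᶜ ≤ a ∧ f xᶜ = ⊥)}
  bot_mem' := by simp
  compl_mem' := by
    rintro x (h | h)
    · right; simpa using h
    · left; exact h
  supClosed' := by
    rintro x (⟨hx, hx'⟩ | ⟨hx, hx'⟩) y (⟨hy, hy'⟩ | ⟨hy, hy'⟩)
    · left; simp [*]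
    all_goals
      right
      rw [compl_sup, InfHomClass.map_inf]
      simp [*, inf_le_of_left_le, inf_le_of_right_le]
  infClosed' := by
    rintro x (⟨hx, hx'⟩ | ⟨hx, hx'⟩) y (⟨hy, hy'⟩ | ⟨hy, hy'⟩)
    · left; simp [*, inf_le_of_left_le]
    · left; simp [*, inf_le_of_left_le]
    · left; simp [*, inf_le_of_right_le]
    · right
      rw [compl_inf, SupHomClass.map_sup]
      simp [*]

theorem mem_kerBelow_iff {f : BoundedLatticeHom B B} {a x : B} (ha : a ≠ ⊤) (hx : x ≤ a) :
    x ∈ kerBelow f a ↔ f x = ⊥ := by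
  refine ⟨?_, fun h ↦ Or.inl ⟨hx, h⟩⟩
  rintro (h | h)
  · exact h.2
  · refine absurd (top_unique ?_) ha
    rw [← sup_compl_eq_top (x := x)]
    exact sup_le hx h.1

theorem apply_eq_bot_iff_of_kerBelow_eq {f g : BoundedLatticeHom B B} {a : B} (ha : a ≠ ⊤)
    (ha' : a ≠ ⊥) (h : kerBelow f a = kerBelow g a) (h' : kerBelow f aᶜ = kerBelow g aᶜ) (x : B) :
    f x = ⊥ ↔ g x = ⊥ := by
  have split (k : BoundedLatticeHom B B) :
      k x = ⊥ ↔ x ⊓ a ∈ kerBelow k a ∧ x ⊓ aᶜ ∈ kerBelow k aᶜ := by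
    rw [mem_kerBelow_iff ha inf_le_right, mem_kerBelow_iff (by simpa using ha') inf_le_right,
      ← sup_eq_bot_iff, ← SupHomClass.map_sup, ← inf_sup_left, sup_compl_eq_top, inf_top_eq]
  rw [split, split, h, h']

/-- Homomorphisms with a common kernel and a common range are determined by the relation they
induce on a dense subalgebra `D` of the range. -/
theorem le_of_rel_eq {C D : BooleanSubalgebra B} (hDC : D ≤ C)
    (hD : ∀ c ∈ C, c ≠ ⊥ → ∃ d ∈ D, d ≤ c ∧ d ≠ ⊥) {e f g : BoundedLatticeHom B B}
    (he : map e ⊤ = C) (hf : map f ⊤ = C) (hg : map g ⊤ = C)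
    (hef : ∀ x, e x = ⊥ ↔ f x = ⊥) (heg : ∀ x, e x = ⊥ ↔ g x = ⊥)
    (h : ∀ d ∈ D, ∀ d' ∈ D, (∃ x, e x = d ∧ d' ≤ f x) → ∃ x, e x = d ∧ d' ≤ g x) (x : B) :
    f x ≤ g x := by
  have memC {k : BoundedLatticeHom B B} (hk : map k ⊤ = C) (y : B) : k y ∈ C :=
    hk ▸ mem_map_of_mem k mem_top
  have le_iff {k : BoundedLatticeHom B B} (hek : ∀ x, e x = ⊥ ↔ k x = ⊥) (y z : B) :
      e y ≤ e z ↔ k y ≤ k z := by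
    rw [← sdiff_eq_bot_iff, ← map_sdiff', hek, map_sdiff', sdiff_eq_bot_iff]
  have key : ∀ y, e y ∈ D → f y ≤ g y := by
    intro y hy
    by_contra hlt
    rw [← sdiff_eq_bot_iff] at hlt
    obtain ⟨d, hd, hle, hd0⟩ := hD _ (sdiff_mem (memC hf y) (memC hg y)) hlt
    obtain ⟨z, hz, hdz⟩ := h _ hy d hd ⟨y, rfl, hle.trans sdiff_le⟩
    exact hd0 (disjoint_self.1 (disjoint_sdiff_self_left.mono hle
      (hdz.trans ((le_iff heg z y).1 hz.le))))
  by_contra hlt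
  rw [← sdiff_eq_bot_iff] at hlt
  have hc : f x \ g x ∈ map f ⊤ := hf ▸ sdiff_mem (memC hf x) (memC hg x)
  obtain ⟨y, -, hy⟩ := hc
  change f y = _ at hy
  have hey : e y ≠ ⊥ := by rwa [Ne, hef, hy]
  obtain ⟨d, hd, hle, hd0⟩ := hD _ (memC he y) hey
  obtain ⟨w, -, hw⟩ : d ∈ map e ⊤ := he ▸ hDC hd
  change e w = d at hw
  subst hw
  -- `f w ≤ f y = f x \ g x`, hence `w` lies below `x` modulo the kernel
  have hwx : g w ≤ g x := by
    rw [← le_iff heg, le_iff hef]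
    exact ((le_iff hef _ _).1 hle).trans (hy.le.trans sdiff_le)
  have hfw : f w ≤ f x \ g x := ((le_iff hef _ _).1 hle).trans hy.le
  have hfw0 : f w = ⊥ := disjoint_self.1 <|
    disjoint_sdiff_self_left.mono hfw ((key w hd).trans hwx)
  exact hd0 ((hef w).2 hfw0)

theorem mk_boundedLatticeHom_le [Infinite B] :
    #(BoundedLatticeHom B B) ≤ #(BooleanSubalgebra B) := by
  classical
  obtain ⟨a, ha⟩ := Infinite.exists_notMem_finset ({⊥, ⊤} : Finset B)
  obtain ⟨ha0, ha1⟩ : a ≠ ⊥ ∧ a ≠ ⊤ := by simpa using ha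
  let code (f : BoundedLatticeHom B B) := (kerBelow f a, kerBelow f aᶜ, map f ⊤)
  have hfib (k) : #(code ⁻¹' {k}) ≤ #(BooleanSubalgebra B) := by
    rcases (code ⁻¹' {k}).eq_empty_or_nonempty with h | ⟨e, rfl⟩
    · simp [h]
    obtain ⟨D, hDC, hD, hcard⟩ := exists_dense_mk_set_prod_le (map e ⊤)
    refine le_trans (mk_le_of_injective (f := fun f : code ⁻¹' {code e} ↦
      {p : D × D | ∃ x, e x = p.1 ∧ p.2 ≤ f.1 x}) ?_) hcard
    have hker (f : code ⁻¹' {code e}) (x : B) : e x = ⊥ ↔ f.1 x = ⊥ :=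
      apply_eq_bot_iff_of_kerBelow_eq ha1 ha0 (congrArg (·.1) f.2).symm
        (congrArg (·.2.1) f.2).symm x
    have hran (f : code ⁻¹' {code e}) : map f.1 ⊤ = map e ⊤ := congrArg (·.2.2) f.2
    intro f g hfg
    refine Subtype.ext (DFunLike.ext _ _ fun x ↦ le_antisymm ?_ ?_)
    · exact le_of_rel_eq hDC hD rfl (hran f) (hran g) (hker f) (hker g)
        (fun d hd d' hd' ↦ (Set.ext_iff.1 hfg (⟨d, hd⟩, ⟨d', hd'⟩)).1) x
    · exact le_of_rel_eq hDC hD rfl (hran g) (hran f) (hker g) (hker f)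
        (fun d hd d' hd' ↦ (Set.ext_iff.1 hfg (⟨d, hd⟩, ⟨d', hd'⟩)).2) x
  refine (mk_le_mk_mul_of_mk_preimage_le code hfib).trans ?_
  simp [mul_eq_self aleph0_le_mk]

end BooleanSubalgebra

/-- For an infinite Boolean algebra, the number of endomorphisms is at most
the number of subalgebras. -/
theorem stmt_5 {B : Type*} [BooleanAlgebra B] [Infinite B] :
    Cardinal.mk {f : B → B // IsBoolHom f} ≤
      Cardinal.mk {S : Set B // IsSubalg S} := by
  let toHom (f : {f : B → B // IsBoolHom f}) : BoundedLatticeHom B B :=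
    { toFun := f.1
      map_sup' := f.2.2.2.1
      map_inf' := f.2.2.2.2.1
      map_top' := f.2.2.1
      map_bot' := f.2.1 }
  have toHom_injective : Function.Injective toHom := fun f g h ↦
    Subtype.ext (congrArg DFunLike.coe h)
  let toSubalg (L : BooleanSubalgebra B) : {S : Set B // IsSubalg S} :=
    ⟨L, L.bot_mem, L.top_mem, fun _ hx _ hy ↦ L.sup_mem hx hy, fun _ hx _ hy ↦ L.inf_mem hx hy,
      fun _ hx ↦ L.compl_mem hx⟩
  have toSubalg_injective : Function.Injective toSubalg := fun L M h ↦
    SetLike.coe_injective (congrArg Subtype.val h)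
  exact (Cardinal.mk_le_of_injective toHom_injective).trans <|
    BooleanSubalgebra.mk_boundedLatticeHom_le.trans <|
      Cardinal.mk_le_of_injective toSubalg_injective
end

section
/- For every infinite Boolean algebra B, the cardinality of the set of partial endomorphisms of B (homomorphisms from a subalgebra of B into B) equals the cardinality of the set of subalgebras of B. -/
/-- A partial endomorphism of `B`: a Boolean homomorphism from a subalgebra
of `B` into `B`. -/
structure Pend (B : Type*) [BooleanAlgebra B] where
  dom : Set B
  isSub : IsSubalg dom
  toFun : dom → B
  map_bot : toFun ⟨⊥, isSub.1⟩ = ⊥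
  map_top : toFun ⟨⊤, isSub.2.1⟩ = ⊤
  map_sup : ∀ x y : dom, toFun ⟨x.1 ⊔ y.1, isSub.2.2.1 x.1 x.2 y.1 y.2⟩ = toFun x ⊔ toFun y
  map_inf : ∀ x y : dom, toFun ⟨x.1 ⊓ y.1, isSub.2.2.2.1 x.1 x.2 y.1 y.2⟩ = toFun x ⊓ toFun y
  map_compl : ∀ x : dom, toFun ⟨(x.1)ᶜ, isSub.2.2.2.2 x.1 x.2⟩ = (toFun x)ᶜ

open Cardinal

universe u

/-- A generalized Boolean subalgebra of `A`: it need not contain `⊤`. -/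
structure IsRelSubalg_s6 {A : Type*} [BooleanAlgebra A] (L : Set A) : Prop where
  bot_mem : ⊥ ∈ L
  sup_mem : ∀ x ∈ L, ∀ y ∈ L, x ⊔ y ∈ L
  sdiff_mem : ∀ x ∈ L, ∀ y ∈ L, x \ y ∈ L

theorem IsSubalg.isRelSubalg {A : Type*} [BooleanAlgebra A] {S : Set A} (hS : IsSubalg S) :
    IsRelSubalg_s6 S :=
  ⟨hS.1, hS.2.2.1, fun x hx y hy => by
    rw [sdiff_eq]; exact hS.2.2.2.1 x hx _ (hS.2.2.2.2 y hy)⟩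

theorem isRelSubalg_of_isLowerSet {A : Type*} [BooleanAlgebra A] {L : Set A} (hL : IsLowerSet L)
    (bot_mem : ⊥ ∈ L) (sup_mem : ∀ x ∈ L, ∀ y ∈ L, x ⊔ y ∈ L) : IsRelSubalg_s6 L :=
  ⟨bot_mem, sup_mem, fun _ hx _ _ => hL sdiff_le hx⟩

namespace IsRelSubalg_s6

variable {A : Type*} [BooleanAlgebra A] {L : Set A}

theorem inf_mem (hL : IsRelSubalg_s6 L) {x y : A} (hx : x ∈ L) (hy : y ∈ L) : x ⊓ y ∈ L := by
  rw [← sdiff_sdiff_right_self]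
  exact hL.sdiff_mem x hx _ (hL.sdiff_mem x hx y hy)

/-- The subalgebra consisting of the elements of `L` and their complements. -/
theorem isSubalg_union_compl (hL : IsRelSubalg_s6 L) : IsSubalg {x | x ∈ L ∨ xᶜ ∈ L} := by
  have hsup : ∀ x y : A, (x ∈ L ∨ xᶜ ∈ L) → (y ∈ L ∨ yᶜ ∈ L) → (x ⊔ y ∈ L ∨ (x ⊔ y)ᶜ ∈ L) := by
    rintro x y (hx | hx) (hy | hy)
    · exact Or.inl (hL.sup_mem x hx y hy)
    · right
      have := hL.sdiff_mem _ hy _ hx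
      rwa [compl_sup, inf_comm, ← sdiff_eq]
    · right
      have := hL.sdiff_mem _ hx _ hy
      rwa [compl_sup, ← sdiff_eq]
    · right
      rw [compl_sup]
      exact hL.inf_mem hx hy
  have hcompl : ∀ x : A, (x ∈ L ∨ xᶜ ∈ L) → (xᶜ ∈ L ∨ xᶜᶜ ∈ L) := by
    intro x hx
    rw [compl_compl]
    exact hx.symm
  refine ⟨Or.inl hL.bot_mem, Or.inr (by simpa using hL.bot_mem), fun x hx y hy => hsup x y hx hy,
    fun x hx y hy => ?_, hcompl⟩
  have := hcompl _ (hsup _ _ (hcompl x hx) (hcompl y hy))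
  rwa [compl_sup, compl_compl, compl_compl] at this

/-- The elements of the ideal generated by `L` that lie below `a`. -/
def below (L : Set A) (a : A) : Set A := {x | x ≤ a ∧ ∃ y ∈ L, x ≤ y}

theorem isRelSubalg_below (hL : IsRelSubalg_s6 L) (a : A) : IsRelSubalg_s6 (below L a) := by
  refine isRelSubalg_of_isLowerSet ?_ ⟨bot_le, ⊥, hL.bot_mem, le_rfl⟩ ?_
  · rintro x y hyx ⟨hxa, z, hz, hxz⟩
    exact ⟨hyx.trans hxa, z, hz, hyx.trans hxz⟩
  · rintro x ⟨hxa, z, hz, hxz⟩ y ⟨hya, w, hw, hyw⟩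
    exact ⟨sup_le hxa hya, z ⊔ w, hL.sup_mem z hz w hw, sup_le_sup hxz hyw⟩

theorem mem_below_iff {a : A} (ha : a ≠ ⊤) {x : A} :
    x ∈ below L a ↔ x ≤ a ∧ (x ∈ below L a ∨ xᶜ ∈ below L a) := by
  refine ⟨fun h => ⟨h.1, Or.inl h⟩, ?_⟩
  rintro ⟨hxa, h | h⟩
  · exact h
  · exact absurd (top_le_iff.1 (sup_compl_eq_top (x := x) ▸ sup_le hxa h.1)) ha

theorem mem_iff {a : A} (hL : IsRelSubalg_s6 L) {x : A} :
    x ∈ L ↔ (x ∈ L ∨ xᶜ ∈ L) ∧ x ⊓ a ∈ below L a ∧ x ⊓ aᶜ ∈ below L aᶜ := by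
  constructor
  · exact fun h => ⟨Or.inl h, ⟨inf_le_right, x, h, inf_le_left⟩, ⟨inf_le_right, x, h, inf_le_left⟩⟩
  · rintro ⟨h | h, ⟨-, y, hy, hxy⟩, ⟨-, z, hz, hxz⟩⟩
    · exact h
    · have hle : x ≤ y ⊔ z := by
        rw [← sup_inf_inf_compl (x := x) (y := a)]
        exact sup_le_sup hxy hxz
      have := hL.sdiff_mem _ (hL.sup_mem y hy z hz) _ (hL.inf_mem h (hL.sup_mem y hy z hz))
      rwa [sdiff_inf_self_right, sdiff_compl, inf_eq_right.2 hle] at this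

end IsRelSubalg_s6

theorem infinite_subalg (B : Type u) [BooleanAlgebra B] [Infinite B] :
    Infinite {S : Set B // IsSubalg S} := by
  by_contra hfin
  rw [not_infinite_iff_finite] at hfin
  have hsub (a : B) : IsSubalg ({⊥, ⊤, a, aᶜ} : Set B) := by
    refine ⟨by simp, by simp, ?_, ?_, ?_⟩
    · rintro x (rfl | rfl | rfl | rfl) y (rfl | rfl | rfl | rfl) <;> simp
    · rintro x (rfl | rfl | rfl | rfl) y (rfl | rfl | rfl | rfl) <;> simp
    · rintro x (rfl | rfl | rfl | rfl) <;> simp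
  let f : B → {S : Set B // IsSubalg S} := fun a => ⟨{⊥, ⊤, a, aᶜ}, hsub a⟩
  refine Set.infinite_univ (α := B) (Set.Finite.of_finite_fibers f (Set.toFinite _) ?_)
  rintro _ ⟨a, -, rfl⟩
  refine Set.Finite.subset (Set.toFinite ({⊥, ⊤, a, aᶜ} : Set B)) ?_
  rintro b ⟨-, hb⟩
  have : ({⊥, ⊤, b, bᶜ} : Set B) = {⊥, ⊤, a, aᶜ} := congrArg Subtype.val hb
  rw [← this]
  simp

theorem aleph0_le_mk_subalg (B : Type u) [BooleanAlgebra B] [Infinite B] :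
    ℵ₀ ≤ #{S : Set B // IsSubalg S} :=
  have := infinite_subalg B
  aleph0_le_mk _

theorem mk_relSubalg_le (B : Type u) [BooleanAlgebra B] [Infinite B] :
    #{L : Set B // IsRelSubalg_s6 L} ≤ #{S : Set B // IsSubalg S} := by
  obtain ⟨a, ha⟩ := Set.Infinite.exists_notMem_finite (Set.infinite_univ (α := B))
    (Set.toFinite {⊥, ⊤})
  have ha₀ : a ≠ ⊥ := fun h => ha.2 (by simp [h])
  have ha₁ : a ≠ ⊤ := fun h => ha.2 (by simp [h])
  let S := {S : Set B // IsSubalg S}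
  let f : {L : Set B // IsRelSubalg_s6 L} → S × S × S := fun L =>
    (⟨_, L.2.isSubalg_union_compl⟩, ⟨_, (L.2.isRelSubalg_below a).isSubalg_union_compl⟩,
      ⟨_, (L.2.isRelSubalg_below aᶜ).isSubalg_union_compl⟩)
  have hf : Function.Injective f := by
    rintro ⟨L, hL⟩ ⟨M, hM⟩ h
    have h₀ : ∀ x, (x ∈ L ∨ xᶜ ∈ L) ↔ (x ∈ M ∨ xᶜ ∈ M) :=
      Set.ext_iff.1 (congrArg (fun t => t.1.1) h)
    have h₁ : ∀ x, (x ∈ IsRelSubalg_s6.below L a ∨ xᶜ ∈ IsRelSubalg_s6.below L a) ↔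
        (x ∈ IsRelSubalg_s6.below M a ∨ xᶜ ∈ IsRelSubalg_s6.below M a) :=
      Set.ext_iff.1 (congrArg (fun t => t.2.1.1) h)
    have h₂ : ∀ x, (x ∈ IsRelSubalg_s6.below L aᶜ ∨ xᶜ ∈ IsRelSubalg_s6.below L aᶜ) ↔
        (x ∈ IsRelSubalg_s6.below M aᶜ ∨ xᶜ ∈ IsRelSubalg_s6.below M aᶜ) :=
      Set.ext_iff.1 (congrArg (fun t => t.2.2.1) h)
    ext x
    rw [hL.mem_iff (a := a), hM.mem_iff (a := a), h₀, IsRelSubalg_s6.mem_below_iff ha₁,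
      IsRelSubalg_s6.mem_below_iff (a := aᶜ) (by simpa using ha₀), h₁, h₂,
      ← IsRelSubalg_s6.mem_below_iff ha₁, ← IsRelSubalg_s6.mem_below_iff (by simpa using ha₀)]
  have hS := aleph0_le_mk_subalg B
  calc _ ≤ #(S × S × S) := mk_le_of_injective hf
    _ = #S := by simp only [mk_prod, lift_id, S]; rw [mul_eq_self hS, mul_eq_self hS]

section Automorphism

variable {A : Type u} [BooleanAlgebra A]

/-- `L` is disjoint from its image under `φ`, elementwise. -/
def IsFree (φ : A ≃o A) (L : Set A) : Prop := ∀ x ∈ L, ∀ y ∈ L, Disjoint x (φ y)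

theorem exists_maximal_isFree (φ : A ≃o A) : ∃ L, Maximal (IsFree φ) L := by
  refine zorn_subset {L | IsFree φ L} fun c hc hchain =>
    ⟨⋃₀ c, ?_, fun s => Set.subset_sUnion_of_mem⟩
  rintro x ⟨s, hs, hx⟩ y ⟨t, ht, hy⟩
  rcases hchain.total hs ht with h | h
  · exact hc ht x (h hx) y hy
  · exact hc hs x hx y (h hy)

theorem mem_of_maximal_isFree {φ : A ≃o A} {L : Set A} (hL : Maximal (IsFree φ) L) {y : A}
    (hy : Disjoint y (φ y)) (h₁ : ∀ l ∈ L, Disjoint y (φ l)) (h₂ : ∀ l ∈ L, Disjoint l (φ y)) :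
    y ∈ L := by
  refine hL.2 (y := insert y L) ?_ (Set.subset_insert y L) (Set.mem_insert y L)
  rintro a (rfl | ha) b (rfl | hb)
  exacts [hy, h₁ b hb, h₂ a ha, hL.1 a ha b hb]

theorem isLowerSet_of_maximal_isFree {φ : A ≃o A} {L : Set A} (hL : Maximal (IsFree φ) L) :
    IsLowerSet L := fun x _ hyx hx =>
  mem_of_maximal_isFree hL ((hL.1 x hx x hx).mono hyx (φ.monotone hyx))
    (fun l hl => (hL.1 x hx l hl).mono_left hyx)
    (fun l hl => (hL.1 l hl x hx).mono_right (φ.monotone hyx))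

theorem isRelSubalg_of_maximal_isFree {φ : A ≃o A} {L : Set A} (hL : Maximal (IsFree φ) L) :
    IsRelSubalg_s6 L := by
  refine isRelSubalg_of_isLowerSet (isLowerSet_of_maximal_isFree hL)
    (mem_of_maximal_isFree hL (by simp) (by simp) (by simp)) fun x hx y hy =>
    mem_of_maximal_isFree hL ?_ ?_ ?_
  · simp [hL.1 x hx x hx, hL.1 x hx y hy, hL.1 y hy x hx, hL.1 y hy y hy]
  · intro l hl
    simp [hL.1 x hx l hl, hL.1 y hy l hl]
  · intro l hl
    simp [hL.1 l hl x hx, hL.1 l hl y hy]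

/-- The elements disjoint from `L` that lie below the image of an element of `L`. -/
def belowImage (φ : A ≃o A) (L : Set A) : Set A :=
  {x | (∃ l ∈ L, x ≤ φ l) ∧ ∀ l ∈ L, Disjoint x l}

/-- The elements disjoint from `L` whose image lies below an element of `L`. -/
def imageBelow (φ : A ≃o A) (L : Set A) : Set A :=
  {x | (∃ l ∈ L, φ x ≤ l) ∧ ∀ l ∈ L, Disjoint x l}

theorem isRelSubalg_belowImage (φ : A ≃o A) {L : Set A} (hL : IsRelSubalg_s6 L) :
    IsRelSubalg_s6 (belowImage φ L) := by
  refine isRelSubalg_of_isLowerSet ?_ ⟨⟨⊥, hL.bot_mem, bot_le⟩, by simp⟩ ?_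
  · rintro x y hyx ⟨⟨l, hl, hxl⟩, hx⟩
    exact ⟨⟨l, hl, hyx.trans hxl⟩, fun m hm => (hx m hm).mono_left hyx⟩
  · rintro x ⟨⟨l, hl, hxl⟩, hx⟩ y ⟨⟨m, hm, hym⟩, hy⟩
    exact ⟨⟨l ⊔ m, hL.sup_mem l hl m hm, by rw [map_sup]; exact sup_le_sup hxl hym⟩,
      fun n hn => (hx n hn).sup_left (hy n hn)⟩

theorem isRelSubalg_imageBelow (φ : A ≃o A) {L : Set A} (hL : IsRelSubalg_s6 L) :
    IsRelSubalg_s6 (imageBelow φ L) := by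
  refine isRelSubalg_of_isLowerSet ?_ ⟨⟨⊥, hL.bot_mem, by simp⟩, by simp⟩ ?_
  · rintro x y hyx ⟨⟨l, hl, hxl⟩, hx⟩
    exact ⟨⟨l, hl, (φ.monotone hyx).trans hxl⟩, fun m hm => (hx m hm).mono_left hyx⟩
  · rintro x ⟨⟨l, hl, hxl⟩, hx⟩ y ⟨⟨m, hm, hym⟩, hy⟩
    exact ⟨⟨l ⊔ m, hL.sup_mem l hl m hm, by rw [map_sup]; exact sup_le_sup hxl hym⟩,
      fun n hn => (hx n hn).sup_left (hy n hn)⟩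

theorem isFree_belowImage (φ : A ≃o A) (L : Set A) : IsFree φ (belowImage φ L) := by
  rintro x ⟨⟨l, hl, hxl⟩, -⟩ y ⟨-, hy⟩
  exact ((hy l hl).symm.map_orderIso φ).mono_left hxl

theorem isFree_imageBelow (φ : A ≃o A) (L : Set A) : IsFree φ (imageBelow φ L) := by
  rintro x ⟨-, hx⟩ y ⟨⟨l, hl, hyl⟩, -⟩
  exact (hx l hl).mono_right hyl

theorem exists_disjoint_image_of_ne (φ : A ≃o A) {x : A} (hx : φ x ≠ x) :
    ∃ y ≤ x, y ≠ ⊥ ∧ Disjoint y (φ y) := by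
  by_cases h : x ≤ φ x
  · refine ⟨x \ φ.symm x, sdiff_le, fun h₀ => hx ?_, ?_⟩
    · rw [sdiff_eq_bot_iff] at h₀
      exact le_antisymm (by simpa using φ.monotone h₀) h
    · have : φ (x \ φ.symm x) = φ x \ x := by simp
      rw [this]
      exact disjoint_sdiff_self_right.mono_left sdiff_le
  · exact ⟨x \ φ x, sdiff_le, by rwa [Ne, sdiff_eq_bot_iff],
      disjoint_sdiff_self_left.mono_right (φ.monotone sdiff_le)⟩

/-- Below each nonzero element that meets none of three suitable free sets, `φ` is the identity. -/
theorem exists_isFree_cover (φ : A ≃o A) :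
    ∃ L : Fin 3 → {L : Set A // IsRelSubalg_s6 L}, (∀ k, IsFree φ (L k).1) ∧
      ∀ c, (∃ k, ∃ y ∈ (L k).1, y ≠ ⊥ ∧ y ≤ c) ∨ ∀ x ≤ c, φ x = x := by
  obtain ⟨L, hL⟩ := exists_maximal_isFree φ
  have hrel := isRelSubalg_of_maximal_isFree hL
  refine ⟨![⟨L, hrel⟩, ⟨_, isRelSubalg_belowImage φ hrel⟩, ⟨_, isRelSubalg_imageBelow φ hrel⟩],
    ?_, fun c => ?_⟩
  · intro k
    fin_cases k
    exacts [hL.1, isFree_belowImage φ L, isFree_imageBelow φ L]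
  by_contra! ⟨hc, x, hxc, hx⟩
  have h₀ : ∀ y ∈ L, y ≤ c → y = ⊥ := fun y hy hyc => by_contra fun h => hc 0 y hy h hyc
  have h₁ : ∀ y ∈ belowImage φ L, y ≤ c → y = ⊥ :=
    fun y hy hyc => by_contra fun h => hc 1 y hy h hyc
  have h₂ : ∀ y ∈ imageBelow φ L, y ≤ c → y = ⊥ :=
    fun y hy hyc => by_contra fun h => hc 2 y hy h hyc
  obtain ⟨y, hyx, hy, hdisj⟩ := exists_disjoint_image_of_ne φ hx
  have hyc := hyx.trans hxc
  have hyL : ∀ l ∈ L, Disjoint y l := fun l hl => disjoint_iff.2 <|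
    h₀ _ (isLowerSet_of_maximal_isFree hL inf_le_right hl) (inf_le_left.trans hyc)
  refine hy (h₀ y (mem_of_maximal_isFree hL hdisj (fun l hl => ?_) (fun l hl => ?_)) hyc)
  · exact disjoint_iff.2 <| h₁ _ ⟨⟨l, hl, inf_le_right⟩,
      fun m hm => (hyL m hm).mono_left inf_le_left⟩ (inf_le_left.trans hyc)
  · have hbot : y ⊓ φ.symm l = ⊥ := h₂ _ ⟨⟨l, hl, by simp⟩,
      fun m hm => (hyL m hm).mono_left inf_le_left⟩ (inf_le_left.trans hyc)
    have := (disjoint_iff.2 hbot).symm.map_orderIso φ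
    simpa using this

theorem isRelSubalg_image_sup {φ : A ≃o A} {L : Set A} (hL : IsRelSubalg_s6 L) (hfree : IsFree φ L) :
    IsRelSubalg_s6 ((fun x => x ⊔ φ x) '' L) := by
  refine ⟨⟨⊥, hL.bot_mem, by simp⟩, ?_, ?_⟩
  · rintro _ ⟨x, hx, rfl⟩ _ ⟨y, hy, rfl⟩
    exact ⟨x ⊔ y, hL.sup_mem x hx y hy, by simp only [map_sup]; exact sup_sup_sup_comm ..⟩
  · rintro _ ⟨x, hx, rfl⟩ _ ⟨y, hy, rfl⟩
    refine ⟨x \ y, hL.sdiff_mem x hx y hy, ?_⟩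
    have h₁ : x \ (y ⊔ φ y) = x \ y := by
      rw [← sdiff_sdiff_left]
      exact ((hfree x hx y hy).mono_left sdiff_le).sdiff_eq_left
    have h₂ : φ x \ (y ⊔ φ y) = φ x \ φ y := by
      rw [sup_comm, ← sdiff_sdiff_left]
      exact ((hfree y hy x hx).symm.mono_left sdiff_le).sdiff_eq_left
    simp only [sup_sdiff, h₁, h₂, map_sdiff']

theorem eqOn_of_image_sup_eq {φ ψ : A ≃o A} {L : Set A} (hφ : IsFree φ L) (hψ : IsFree ψ L)
    (h : (fun x => x ⊔ φ x) '' L = (fun x => x ⊔ ψ x) '' L) : Set.EqOn φ ψ L := by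
  intro x hx
  obtain ⟨y, hy, hxy⟩ := h ▸ Set.mem_image_of_mem (fun x => x ⊔ φ x) hx
  replace hxy : y ⊔ ψ y = x ⊔ φ x := hxy
  have h₁ : x ≤ y := (hψ x hx y hy).left_le_of_le_sup_right (hxy ▸ le_sup_left)
  have h₂ : y ≤ x := (hφ y hy x hx).left_le_of_le_sup_right (hxy ▸ le_sup_left)
  obtain rfl := le_antisymm h₁ h₂
  refine le_antisymm ?_ ?_
  · exact (hφ x hx x hx).symm.left_le_of_le_sup_left (hxy ▸ le_sup_right)
  · exact (hψ x hx x hx).symm.left_le_of_le_sup_left (hxy ▸ le_sup_right)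

theorem le_of_eqOn_cover {ι : Type*} {φ ψ : A ≃o A} {L : ι → Set A}
    (heq : ∀ k, Set.EqOn φ ψ (L k))
    (hφ : ∀ c, (∃ k, ∃ y ∈ L k, y ≠ ⊥ ∧ y ≤ c) ∨ ∀ x ≤ c, φ x = x)
    (hψ : ∀ c, (∃ k, ∃ y ∈ L k, y ≠ ⊥ ∧ y ≤ c) ∨ ∀ x ≤ c, ψ x = x) (x : A) : φ x ≤ ψ x := by
  set m := φ x \ ψ x with hm
  have hmφ : m ≤ φ x := sdiff_le
  have hmψ : Disjoint m (ψ x) := disjoint_sdiff_self_left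
  have key : ∀ y, φ y = ψ y → φ y ≤ m → y = ⊥ := by
    intro y hy hym
    have hyx : y ≤ x := φ.le_iff_le.1 (hym.trans hmφ)
    have : ψ y = ⊥ := le_bot_iff.1 (hmψ (hy ▸ hym) (ψ.monotone hyx))
    simpa using this
  rw [← sdiff_eq_bot_iff, ← hm]
  rcases hφ (φ.symm m) with ⟨k, y, hy, hy₀, hym⟩ | hfixφ
  · exact absurd (key y (heq k hy) (by simpa using φ.monotone hym)) hy₀
  rcases hψ (ψ.symm m) with ⟨k, y, hy, hy₀, hym⟩ | hfixψ
  · exact absurd (key y (heq k hy) (by rw [heq k hy]; simpa using ψ.monotone hym)) hy₀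
  have h₁ : m = φ.symm m := by simpa using hfixφ _ le_rfl
  have h₂ : m = ψ.symm m := by simpa using hfixψ _ le_rfl
  refine key m ?_ ?_
  · rw [← φ.symm_apply_eq.1 h₁.symm, ← ψ.symm_apply_eq.1 h₂.symm]
  · rw [← φ.symm_apply_eq.1 h₁.symm]

theorem mk_orderIso_le (A : Type u) [BooleanAlgebra A] :
    #(A ≃o A) ≤
      #((Fin 3 → {L : Set A // IsRelSubalg_s6 L}) × (Fin 3 → {L : Set A // IsRelSubalg_s6 L})) := by
  choose L hfree hcover using exists_isFree_cover (A := A)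
  refine mk_le_of_injective
    (f := fun φ => (L φ, fun k => ⟨_, isRelSubalg_image_sup (L φ k).2 (hfree φ k)⟩)) ?_
  intro φ ψ h
  obtain ⟨hL, hW⟩ := Prod.mk.inj h
  have hfree' : ∀ k, IsFree ψ (L φ k).1 := hL ▸ hfree ψ
  have hcover' : ∀ c, (∃ k, ∃ y ∈ (L φ k).1, y ≠ ⊥ ∧ y ≤ c) ∨ ∀ x ≤ c, ψ x = x := hL ▸ hcover ψ
  have heq : ∀ k, Set.EqOn φ ψ (L φ k).1 := fun k => by
    refine eqOn_of_image_sup_eq (hfree φ k) (hfree' k) ?_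
    have := congrArg Subtype.val (congrFun hW k)
    simpa only [← hL] using this
  ext x
  exact le_antisymm (le_of_eqOn_cover heq (hcover φ) hcover' x)
    (le_of_eqOn_cover (fun k => (heq k).symm) hcover' (hcover φ) x)

end Automorphism

theorem mk_relSubalg_coe_le {B : Type u} [BooleanAlgebra B] (D : BooleanSubalgebra B) :
    #{L : Set D // IsRelSubalg_s6 L} ≤ #{L : Set B // IsRelSubalg_s6 L} := by
  refine mk_le_of_injective (f := fun L => ⟨Subtype.val '' L.1, ?_, ?_, ?_⟩) ?_
  · exact ⟨⊥, L.2.bot_mem, rfl⟩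
  · rintro _ ⟨x, hx, rfl⟩ _ ⟨y, hy, rfl⟩
    exact ⟨x ⊔ y, L.2.sup_mem x hx y hy, rfl⟩
  · rintro _ ⟨x, hx, rfl⟩ _ ⟨y, hy, rfl⟩
    exact ⟨x \ y, L.2.sdiff_mem x hx y hy, rfl⟩
  · intro L M h
    exact Subtype.ext (Subtype.val_injective.image_injective (congrArg Subtype.val h))

theorem mk_orderIso_coe_le {B : Type u} [BooleanAlgebra B] [Infinite B] (D : BooleanSubalgebra B) :
    #(D ≃o D) ≤ #{S : Set B // IsSubalg S} := by
  have h := (mk_relSubalg_coe_le D).trans (mk_relSubalg_le B)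
  have hS := aleph0_le_mk_subalg B
  refine (mk_orderIso_le D).trans ?_
  have h₃ : #(Fin 3 → {L : Set D // IsRelSubalg_s6 L}) ≤ #{S : Set B // IsSubalg S} := by
    simp only [mk_arrow, lift_uzero, mk_fin, lift_natCast]
    exact (power_le_power_right h).trans (power_nat_le hS)
  rw [mk_prod, lift_id]
  exact (mul_le_mul' h₃ h₃).trans (mul_eq_self hS).le

/-- Two surjections inducing the same preorder differ by an order isomorphism. -/
theorem exists_orderIso_comp_eq {α β γ : Type*} [PartialOrder β] [PartialOrder γ] {f : α → β}
    {g : α → γ} (hf : Function.Surjective f) (hg : Function.Surjective g)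
    (h : ∀ x y, f x ≤ f y ↔ g x ≤ g y) : ∃ e : β ≃o γ, ∀ x, e (f x) = g x := by
  have heq : ∀ x y, f x = f y ↔ g x = g y := fun x y => by
    simp only [le_antisymm_iff, h]
  have hf' := Function.surjInv_eq hf
  have hg' := Function.surjInv_eq hg
  let e : β ≃ γ :=
    { toFun := fun b => g (Function.surjInv hf b)
      invFun := fun c => f (Function.surjInv hg c)
      left_inv := fun b => ((heq _ _).2 (hg' _)).trans (hf' b)
      right_inv := fun c => ((heq _ _).1 (hf' _)).trans (hg' c) }
  refine ⟨⟨e, fun {a b} => ?_⟩, fun x => (heq _ _).1 (hf' (f x))⟩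
  change g _ ≤ g _ ↔ _
  rw [← h, hf', hf']

namespace Pend

variable {B : Type u} [BooleanAlgebra B]

/-- The kernel of a partial endomorphism. -/
def ker (p : Pend B) : Set B := {x | ∃ hx : x ∈ p.dom, p.toFun ⟨x, hx⟩ = ⊥}

theorem map_sdiff (p : Pend B) (x y : p.dom) :
    p.toFun ⟨x.1 \ y.1, p.isSub.isRelSubalg.sdiff_mem x.1 x.2 y.1 y.2⟩ =
      p.toFun x \ p.toFun y := by
  have h := p.map_inf x ⟨y.1ᶜ, p.isSub.2.2.2.2 y.1 y.2⟩
  rw [p.map_compl] at h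
  simpa only [sdiff_eq] using h

theorem isRelSubalg_ker (p : Pend B) : IsRelSubalg_s6 p.ker := by
  refine ⟨⟨_, p.map_bot⟩, ?_, ?_⟩
  · rintro x ⟨hx, hx'⟩ y ⟨hy, hy'⟩
    exact ⟨p.isSub.2.2.1 x hx y hy, by rw [p.map_sup ⟨x, hx⟩ ⟨y, hy⟩, hx', hy', sup_bot_eq]⟩
  · rintro x ⟨hx, hx'⟩ y ⟨hy, hy'⟩
    exact ⟨p.isSub.isRelSubalg.sdiff_mem x hx y hy,
      by rw [p.map_sdiff ⟨x, hx⟩ ⟨y, hy⟩, hx', bot_sdiff]⟩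

theorem le_iff_sdiff_mem_ker (p : Pend B) (x y : p.dom) :
    p.toFun x ≤ p.toFun y ↔ x.1 \ y.1 ∈ p.ker := by
  rw [← sdiff_eq_bot_iff, ← p.map_sdiff]
  exact ⟨fun h => ⟨_, h⟩, fun ⟨_, h⟩ => h⟩

/-- The image of a partial endomorphism. -/
def range (p : Pend B) : BooleanSubalgebra B where
  carrier := Set.range p.toFun
  supClosed' := by
    rintro _ ⟨x, rfl⟩ _ ⟨y, rfl⟩
    exact ⟨_, p.map_sup x y⟩
  infClosed' := by
    rintro _ ⟨x, rfl⟩ _ ⟨y, rfl⟩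
    exact ⟨_, p.map_inf x y⟩
  compl_mem' := by
    rintro _ ⟨x, rfl⟩
    exact ⟨_, p.map_compl x⟩
  bot_mem' := ⟨_, p.map_bot⟩

theorem ext_toFun {p q : Pend B} (hdom : p.dom = q.dom)
    (h : ∀ x (hp : x ∈ p.dom) (hq : x ∈ q.dom), p.toFun ⟨x, hp⟩ = q.toFun ⟨x, hq⟩) : p = q := by
  obtain ⟨C, _, f, _⟩ := p
  obtain ⟨C', _, g, _⟩ := q
  obtain rfl : C = C' := hdom
  obtain rfl : f = g := funext fun x => h x.1 x.2 x.2
  rfl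

theorem exists_orderIso_range {p q : Pend B} (hdom : p.dom = q.dom) (hker : p.ker = q.ker)
    (hrange : p.range = q.range) : ∃ e : p.range ≃o p.range,
      ∀ x (hp : x ∈ p.dom) (hq : x ∈ q.dom),
        (e ⟨p.toFun ⟨x, hp⟩, ⟨x, hp⟩, rfl⟩ : B) = q.toFun ⟨x, hq⟩ := by
  have hmem (x : p.dom) : q.toFun ⟨x.1, hdom ▸ x.2⟩ ∈ p.range := hrange ▸ ⟨_, rfl⟩
  let f : p.dom → p.range := fun x => ⟨p.toFun x, x, rfl⟩
  let g : p.dom → p.range := fun x => ⟨q.toFun ⟨x.1, hdom ▸ x.2⟩, hmem x⟩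
  have hf : Function.Surjective f := by
    rintro ⟨_, x, rfl⟩
    exact ⟨x, rfl⟩
  have hg : Function.Surjective g := by
    rintro ⟨b, hb⟩
    obtain ⟨x, rfl⟩ : b ∈ q.range := hrange ▸ hb
    exact ⟨⟨x.1, hdom.symm.subset x.2⟩, rfl⟩
  have hle (x y : p.dom) : f x ≤ f y ↔ g x ≤ g y := by
    change p.toFun x ≤ p.toFun y ↔ q.toFun _ ≤ q.toFun _
    rw [p.le_iff_sdiff_mem_ker, q.le_iff_sdiff_mem_ker, hker]
  obtain ⟨e, he⟩ := exists_orderIso_comp_eq hf hg hle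
  exact ⟨e, fun x hp hq => congrArg Subtype.val (he ⟨x, hp⟩)⟩

theorem mk_fiber_le [Infinite B] (p : Pend B) :
    #{q : Pend B // p.dom = q.dom ∧ p.ker = q.ker ∧ p.range = q.range} ≤
      #{S : Set B // IsSubalg S} := by
  refine le_trans ?_ (mk_orderIso_coe_le p.range)
  choose e he using fun q : {q : Pend B // p.dom = q.dom ∧ p.ker = q.ker ∧ p.range = q.range} =>
    exists_orderIso_range q.2.1 q.2.2.1 q.2.2.2
  refine mk_le_of_injective (f := e) fun q r h => Subtype.ext ?_
  refine ext_toFun (q.2.1.symm.trans r.2.1) fun x hq hr => ?_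
  have hp : x ∈ p.dom := q.2.1 ▸ hq
  rw [← he q x hp hq, ← he r x hp hr, h]

end Pend

theorem isSubalg_coe {B : Type u} [BooleanAlgebra B] (D : BooleanSubalgebra B) :
    IsSubalg (D : Set B) :=
  ⟨D.bot_mem, D.top_mem, fun _ hx _ hy => D.sup_mem hx hy, fun _ hx _ hy => D.inf_mem hx hy,
    fun _ hx => D.compl_mem hx⟩

theorem mk_pend_le (B : Type u) [BooleanAlgebra B] [Infinite B] :
    #(Pend B) ≤ #{S : Set B // IsSubalg S} := by
  let S := {S : Set B // IsSubalg S}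
  let R := {L : Set B // IsRelSubalg_s6 L}
  have hS : ℵ₀ ≤ #S := aleph0_le_mk_subalg B
  let f : Pend B → S × R × S := fun p =>
    (⟨p.dom, p.isSub⟩, ⟨p.ker, p.isRelSubalg_ker⟩, ⟨p.range, isSubalg_coe p.range⟩)
  have hfiber : ∀ t, #{q : Pend B // f q = t} ≤ #S := by
    intro t
    by_cases ht : ∃ p, f p = t
    · obtain ⟨p, rfl⟩ := ht
      refine (mk_subtype_mono fun q hq => ?_).trans p.mk_fiber_le
      exact ⟨congrArg (fun t => t.1.1) hq.symm, congrArg (fun t => t.2.1.1) hq.symm,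
        SetLike.coe_injective (congrArg (fun t => t.2.2.1) hq.symm)⟩
    · have : IsEmpty {q : Pend B // f q = t} := ⟨fun q => ht ⟨q.1, q.2⟩⟩
      simp
  have hR : #R * #S ≤ #S := (mul_le_mul_left (mk_relSubalg_le B) _).trans (mul_eq_self hS).le
  calc #(Pend B) = sum fun t => #{q : Pend B // f q = t} := by
        rw [← mk_sigma]; exact (mk_congr (Equiv.sigmaFiberEquiv f)).symm
    _ ≤ sum fun _ : S × R × S => #S := sum_le_sum _ _ hfiber
    _ = #S * (#R * #S) * #S := by rw [sum_const']; simp only [mk_prod, lift_id]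
    _ ≤ #S * #S * #S := by gcongr
    _ = #S := by rw [mul_eq_self hS, mul_eq_self hS]

/-- For an infinite Boolean algebra, the number of partial endomorphisms
equals the number of subalgebras. -/
theorem stmt_6 {B : Type*} [BooleanAlgebra B] [Infinite B] :
    Cardinal.mk (Pend B) = Cardinal.mk {S : Set B // IsSubalg S} := by
  refine le_antisymm (mk_pend_le B) (mk_le_of_injective (f := fun S =>
    { dom := S.1, isSub := S.2, toFun := Subtype.val, map_bot := rfl, map_top := rfl,
      map_sup := fun _ _ => rfl, map_inf := fun _ _ => rfl, map_compl := fun _ => rfl }) ?_)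
  exact fun S T h => Subtype.ext (congrArg Pend.dom h)
end

section
/- Let B be an infinite Boolean algebra and a ∈ B with 0 < a < 1. Then the number of subalgebras of B equals the maximum of the number of subalgebras of B ↾ a and the number of subalgebras of B ↾ (1 − a). -/
/-- A subalgebra of the relative Boolean algebra `B ↾ a` (elements `≤ a`,
with top `a` and relative complement `a \ x`), as a subset of `B`. -/
def IsRelSubalg {B : Type*} [BooleanAlgebra B] (a : B) (S : Set B) : Prop :=
  (∀ x ∈ S, x ≤ a) ∧ ⊥ ∈ S ∧ a ∈ S ∧ (∀ x ∈ S, ∀ y ∈ S, x ⊔ y ∈ S) ∧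
    (∀ x ∈ S, ∀ y ∈ S, x ⊓ y ∈ S) ∧ (∀ x ∈ S, a \ x ∈ S)


open Cardinal Function
open scoped symmDiff

universe u

section Ideals

variable {D : Type u} [BooleanAlgebra D]

/-- The subalgebra consisting of the elements of a subring `R` (a set containing `⊥` and closed
under `⊔` and `\`) together with their complements. -/
def BooleanSubalgebra.ofSubring (R : Set D) (bot : ⊥ ∈ R)
    (sup : ∀ x ∈ R, ∀ y ∈ R, x ⊔ y ∈ R) (sdiff : ∀ x ∈ R, ∀ y ∈ R, x \ y ∈ R) :
    BooleanSubalgebra D where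
  carrier := {t | t ∈ R ∨ tᶜ ∈ R}
  bot_mem' := Or.inl bot
  compl_mem' := by
    intro t ht
    simpa [or_comm] using ht
  supClosed' := by
    have inf : ∀ x ∈ R, ∀ y ∈ R, x ⊓ y ∈ R := fun x hx y hy ↦ by
      rw [← sdiff_sdiff_right_self]; exact sdiff x hx _ (sdiff x hx y hy)
    rintro s (hs | hs) t (ht | ht)
    · exact Or.inl (sup s hs t ht)
    · right
      rw [compl_sup, inf_comm, ← sdiff_eq]
      exact sdiff _ ht _ hs
    · right
      rw [compl_sup, ← sdiff_eq]
      exact sdiff _ hs _ ht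
    · right
      rw [compl_sup]
      exact inf _ hs _ ht
  infClosed' := by
    have inf : ∀ x ∈ R, ∀ y ∈ R, x ⊓ y ∈ R := fun x hx y hy ↦ by
      rw [← sdiff_sdiff_right_self]; exact sdiff x hx _ (sdiff x hx y hy)
    rintro s (hs | hs) t (ht | ht)
    · exact Or.inl (inf s hs t ht)
    · left
      rw [← compl_compl t, ← sdiff_eq]
      exact sdiff _ hs _ ht
    · left
      rw [← compl_compl s, inf_comm, ← sdiff_eq]
      exact sdiff _ ht _ hs
    · right
      rw [compl_inf]
      exact sup _ hs _ ht

/-- The subalgebra generated by the part of an ideal that lies below `a`. -/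
def Order.Ideal.subalgebraBelow (I : Order.Ideal D) (a : D) : BooleanSubalgebra D :=
  .ofSubring {x | x ∈ I ∧ x ≤ a} ⟨I.bot_mem, bot_le⟩
    (fun _ hx _ hy ↦ ⟨Order.Ideal.sup_mem hx.1 hy.1, sup_le hx.2 hy.2⟩)
    (fun _ hx _ _ ↦ ⟨I.lower sdiff_le hx.1, sdiff_le.trans hx.2⟩)

theorem Order.Ideal.mem_subalgebraBelow_iff (I : Order.Ideal D) {a x : D} (ha : a ≠ ⊤)
    (hx : x ≤ a) : x ∈ I.subalgebraBelow a ↔ x ∈ I := by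
  refine ⟨?_, fun h ↦ Or.inl ⟨h, hx⟩⟩
  rintro (h | h)
  · exact h.1
  · refine absurd (top_le_iff.1 ?_) ha
    rw [← sup_compl_eq_top (x := x)]
    exact sup_le hx h.2

theorem mk_ideal_le {κ : Cardinal.{u}} (hκ : ℵ₀ ≤ κ) (h : #(BooleanSubalgebra D) ≤ κ) :
    #(Order.Ideal D) ≤ κ := by
  by_cases hD : ∃ a : D, a ≠ ⊥ ∧ a ≠ ⊤
  · obtain ⟨a, ha0, ha1⟩ := hD
    have hinj : Injective fun I : Order.Ideal D ↦
        (I.subalgebraBelow a, I.subalgebraBelow aᶜ) := by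
      intro I J hIJ
      simp only [Prod.mk.injEq] at hIJ
      have h1 : ∀ x ≤ a, x ∈ I ↔ x ∈ J := fun x hx ↦ by
        rw [← I.mem_subalgebraBelow_iff ha1 hx, hIJ.1, J.mem_subalgebraBelow_iff ha1 hx]
      have h2 : ∀ x ≤ aᶜ, x ∈ I ↔ x ∈ J := fun x hx ↦ by
        have ha : aᶜ ≠ ⊤ := by simpa using ha0
        rw [← I.mem_subalgebraBelow_iff ha hx, hIJ.2, J.mem_subalgebraBelow_iff ha hx]
      ext x
      rw [SetLike.mem_coe, SetLike.mem_coe, ← sup_inf_inf_compl (x := x) (y := a),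
        Order.Ideal.sup_mem_iff, Order.Ideal.sup_mem_iff, h1 _ inf_le_right, h2 _ inf_le_right]
    calc #(Order.Ideal D) ≤ #(BooleanSubalgebra D × BooleanSubalgebra D) :=
          mk_le_of_injective hinj
      _ ≤ κ := by
          rw [mk_prod, lift_id]
          exact mul_le_of_le hκ h h
  · have hfin : Finite D := by
      refine Set.finite_univ_iff.1 ((Set.toFinite {⊥, ⊤}).subset fun x _ ↦ ?_)
      by_contra hx
      exact hD ⟨x, by simpa using hx⟩
    have : Finite (Order.Ideal D) := Finite.of_injective _ (SetLike.coe_injective (A := Order.Ideal D))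
    exact (lt_aleph0_of_finite _).le.trans hκ

theorem exists_quotient (I : Order.Ideal D) :
    ∃ (Q : Type u) (_ : BooleanAlgebra Q) (π : BoundedLatticeHom D Q),
      Surjective π ∧ ∀ x y, π x = π y ↔ x ∆ y ∈ I := by
  let J : Ideal (AsBoolRing D) :=
    { carrier := {x | ofBoolRing x ∈ I}
      zero_mem' := I.bot_mem
      add_mem' := fun {x y} hx hy ↦ I.lower (symmDiff_le_sup (a := ofBoolRing x)
        (b := ofBoolRing y)) (Order.Ideal.sup_mem hx hy)
      smul_mem' := fun c x hx ↦ I.lower (inf_le_right (a := ofBoolRing c)) hx }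
  let _ : BooleanRing (AsBoolRing D ⧸ J) :=
    { (inferInstance : CommRing (AsBoolRing D ⧸ J)) with
      isIdempotentElem := by
        intro x
        obtain ⟨x, rfl⟩ := Ideal.Quotient.mk_surjective x
        exact (map_mul (Ideal.Quotient.mk J) x x).symm.trans
          (congrArg _ (BooleanRing.isIdempotentElem x)) }
  let ρ : AsBoolRing D →+* AsBoolRing D ⧸ J := Ideal.Quotient.mk J
  let π : BoundedLatticeHom (AsBoolAlg (AsBoolRing D)) (AsBoolAlg (AsBoolRing D ⧸ J)) :=
    RingHom.asBoolAlg ρ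
  let e : BoundedLatticeHom D (AsBoolAlg (AsBoolRing D)) :=
    (OrderIso.asBoolAlgAsBoolRing D).symm
  refine ⟨AsBoolAlg (AsBoolRing D ⧸ J), inferInstance, π.comp e, ?_, ?_⟩
  · intro q
    obtain ⟨x, hx⟩ := Ideal.Quotient.mk_surjective (I := J) q
    exact ⟨x, hx⟩
  · intro x y
    exact Ideal.Quotient.eq (I := J) (x := toBoolRing x) (y := toBoolRing y)

end Ideals

theorem mk_booleanSubalgebra_le_of_surjective {A D : Type u} [BooleanAlgebra A]
    [BooleanAlgebra D] (f : BoundedLatticeHom A D) (hf : Surjective f) :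
    #(BooleanSubalgebra D) ≤ #(BooleanSubalgebra A) := by
  refine mk_le_of_injective (f := BooleanSubalgebra.comap f) fun L M h ↦ ?_
  exact SetLike.coe_injective (hf.preimage_injective (congrArg SetLike.coe h))

theorem mk_booleanSubalgebra_le_of_injective {A D : Type u} [BooleanAlgebra A]
    [BooleanAlgebra D] (f : BoundedLatticeHom A D) (hf : Injective f) :
    #(BooleanSubalgebra A) ≤ #(BooleanSubalgebra D) := by
  refine mk_le_of_injective (f := BooleanSubalgebra.map f) fun L M h ↦ ?_
  exact SetLike.coe_injective (hf.image_injective (congrArg SetLike.coe h))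

theorem aleph0_le_mk_booleanSubalgebra (D : Type u) [BooleanAlgebra D] [Infinite D] :
    ℵ₀ ≤ #(BooleanSubalgebra D) := by
  rw [← infinite_iff]
  by_contra hfin
  rw [not_infinite_iff_finite] at hfin
  let s : D → BooleanSubalgebra D := fun x ↦
    .ofSubring {⊥, x} (by simp) (by simp) (by simp)
  have hs : ∀ x, (s x : Set D).Finite := fun x ↦
    (Set.toFinite {⊥, x}).union
      ((Set.toFinite {⊥, x}).preimage (compl_injective.injOn (s := _)))
  have hcover : (⋃ S ∈ Set.range s, (S : Set D)).Finite := by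
    refine (Set.toFinite (Set.range s)).biUnion ?_
    rintro _ ⟨x, rfl⟩
    exact hs x
  exact Set.infinite_univ (hcover.subset fun x _ ↦
    Set.mem_biUnion (Set.mem_range_self x) (Or.inl (by simp)))

section Automorphisms

variable {D : Type u} [BooleanAlgebra D]

/-- The preimage of an ideal under an order isomorphism. -/
def Order.Ideal.comapIso (I : Order.Ideal D) (e : D ≃o D) : Order.Ideal D where
  carrier := e ⁻¹' I
  lower' := fun _ _ h hx ↦ I.lower (e.monotone h) hx
  nonempty' := ⟨⊥, by simp⟩
  directed' := fun x hx y hy ↦ ⟨x ⊔ y, by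
    simpa using And.intro hx hy, le_sup_left, le_sup_right⟩

theorem Order.Ideal.mem_comapIso {I : Order.Ideal D} {e : D ≃o D} {x : D} :
    x ∈ I.comapIso e ↔ e x ∈ I := Iff.rfl

/-- The subalgebra generated by the elements `y ⊔ f y` for `y` in the ideal `W`. -/
def graphSubalgebra (f : D ≃o D) (W : Order.Ideal D) : BooleanSubalgebra D :=
  BooleanSubalgebra.closure ((fun y ↦ y ⊔ f y) '' W)

theorem mem_graphSubalgebra {f : D ≃o D} {W : Order.Ideal D}
    (hW : ∀ y ∈ W, ∀ z ∈ W, Disjoint y (f z)) {t : D} (ht : t ∈ graphSubalgebra f W) :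
    (∃ y ∈ W, y ⊔ f y = t) ∨ ∃ y ∈ W, y ⊔ f y = tᶜ := by
  let S : BooleanSubalgebra D := .ofSubring ((fun y ↦ y ⊔ f y) '' W)
    ⟨⊥, W.bot_mem, by simp⟩
    (by
      rintro _ ⟨y, hy, rfl⟩ _ ⟨z, hz, rfl⟩
      exact ⟨y ⊔ z, Order.Ideal.sup_mem hy hz, by
        simp only [map_sup]; exact sup_sup_sup_comm _ _ _ _⟩)
    (by
      rintro _ ⟨y, hy, rfl⟩ _ ⟨z, hz, rfl⟩
      refine ⟨y \ z, W.lower sdiff_le hy, ?_⟩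
      have h1 : y \ (z ⊔ f z) = y \ z := by
        rw [← sdiff_sdiff, ((hW y hy z hz).mono_left sdiff_le).sdiff_eq_left]
      have h2 : f y \ (z ⊔ f z) = f y \ f z := by
        rw [← sdiff_sdiff, (hW z hz y hy).symm.sdiff_eq_left]
      simp only [map_sdiff', sup_sdiff, h1, h2])
  exact BooleanSubalgebra.closure_le (L := S).2 (fun _ h ↦ Or.inl h) ht

theorem eq_of_sup_mem_graphSubalgebra {f : D ≃o D} {W : Order.Ideal D}
    (hW : ∀ y ∈ W, ∀ z ∈ W, Disjoint y (f z)) {y v : D} (hy : y ∈ W) (hv : v ∈ W)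
    (h : y ⊔ f v ∈ graphSubalgebra f W) : y = v := by
  rcases mem_graphSubalgebra hW h with ⟨w, hw, e⟩ | ⟨w, hw, e⟩
  · have h1 : y = w := by
      apply le_antisymm
      · exact (hW y hy w hw).left_le_of_le_sup_right (le_sup_left.trans e.ge)
      · exact (hW w hw v hv).left_le_of_le_sup_right (le_sup_left.trans e.le)
    have h2 : f v = f w := by
      apply le_antisymm
      · exact (hW w hw v hv).symm.left_le_of_le_sup_left (le_sup_right.trans e.ge)
      · exact (hW y hy w hw).symm.left_le_of_le_sup_left (le_sup_right.trans e.le)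
    rw [h1, f.injective h2]
  · have hd : Disjoint (y ⊔ f v) (w ⊔ f w) := e ▸ disjoint_compl_right
    have htop : y ⊔ f v ⊔ (w ⊔ f w) = ⊤ := by rw [e]; exact sup_compl_eq_top
    rw [disjoint_sup_left, disjoint_sup_right, disjoint_sup_right] at hd
    have hvw : Disjoint v w := (disjoint_map_orderIso_iff f).1 hd.2.2
    rw [sup_sup_sup_comm, ← map_sup] at htop
    have hcover : ∀ x ∈ W, x ≤ y ⊔ w := fun x hx ↦
      (hW x hx _ (Order.Ideal.sup_mem hv hw)).left_le_of_le_sup_right (htop ▸ le_top)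
    have hcover' : ∀ x ∈ W, x ≤ v ⊔ w := fun x hx ↦ by
      refine f.le_iff_le.1 ?_
      exact (hW (y ⊔ w) (Order.Ideal.sup_mem hy hw) x hx).symm.left_le_of_le_sup_left (htop ▸ le_top)
    exact le_antisymm (hd.1.1.left_le_of_le_sup_right (hcover' y hy))
      (hvw.left_le_of_le_sup_right (hcover v hv))

theorem eqOn_of_graphSubalgebra_eq {f g : D ≃o D} {W : Order.Ideal D}
    (hf : ∀ y ∈ W, ∀ z ∈ W, Disjoint y (f z))
    (himage : W.comapIso f.symm = W.comapIso g.symm)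
    (hT : graphSubalgebra f W = graphSubalgebra g W) {y : D} (hy : y ∈ W) : f y = g y := by
  have hv : g y ∈ W.comapIso f.symm := by
    rw [himage, Order.Ideal.mem_comapIso]; simpa using hy
  have hmem : y ⊔ f (f.symm (g y)) ∈ graphSubalgebra f W := by
    rw [hT, f.apply_symm_apply]
    exact BooleanSubalgebra.subset_closure ⟨y, hy, rfl⟩
  exact (congrArg f (eq_of_sup_mem_graphSubalgebra hf hy hv hmem)).trans (f.apply_symm_apply _)

/-- Every automorphism `f` has a maximal ideal `V` among those disjoint from their image. -/
theorem exists_maximal_disjoint_ideal (f : D ≃o D) :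
    ∃ V : Order.Ideal D, (∀ y ∈ V, ∀ z ∈ V, Disjoint y (f z)) ∧
      ∀ w, Disjoint w (f w) → (∀ v ∈ V, Disjoint w (f v) ∧ Disjoint v (f w)) → w ∈ V := by
  obtain ⟨V, hV⟩ := zorn_subset {V : Set D | ∀ y ∈ V, ∀ z ∈ V, Disjoint y (f z)} (by
    intro c hc hchain
    refine ⟨⋃₀ c, ?_, fun s hs ↦ Set.subset_sUnion_of_mem hs⟩
    rintro y ⟨s, hs, hys⟩ z ⟨t, ht, hzt⟩
    rcases hchain.total hs ht with h | h
    · exact hc ht y (h hys) z hzt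
    · exact hc hs y hys z (h hzt))
  have hdisj : ∀ y ∈ V, ∀ z ∈ V, Disjoint y (f z) := hV.prop
  have hmax : ∀ w, Disjoint w (f w) → (∀ v ∈ V, Disjoint w (f v) ∧ Disjoint v (f w)) →
      w ∈ V := by
    intro w hw hwV
    refine hV.le_of_ge (y := insert w V) ?_ (Set.subset_insert _ _) (Set.mem_insert _ _)
    rintro y (rfl | hy) z (rfl | hz)
    exacts [hw, (hwV z hz).1, (hwV y hy).2, hdisj y hy z hz]
  refine ⟨⟨⟨V, ?_⟩, ⟨⊥, ?_⟩, ?_⟩, hdisj, hmax⟩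
  · intro x y hyx hx
    exact hmax y ((hdisj x hx x hx).mono hyx (f.monotone hyx)) fun v hv ↦
      ⟨(hdisj x hx v hv).mono_left hyx, (hdisj v hv x hx).mono_right (f.monotone hyx)⟩
  · exact hmax ⊥ disjoint_bot_left fun v _ ↦ by simp
  · intro x hx y hy
    refine ⟨x ⊔ y, hmax _ ?_ fun v hv ↦ ?_, le_sup_left, le_sup_right⟩
    · simp only [map_sup, disjoint_sup_left, disjoint_sup_right]
      exact ⟨⟨hdisj x hx x hx, hdisj y hy x hx⟩, hdisj x hx y hy, hdisj y hy y hy⟩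
    · simp only [map_sup, disjoint_sup_left, disjoint_sup_right]
      exact ⟨⟨hdisj x hx v hv, hdisj y hy v hv⟩, hdisj v hv x hx, hdisj v hv y hy⟩

theorem apply_eq_self_of_disjoint {f : D ≃o D} {V : Order.Ideal D}
    (hmax : ∀ w, Disjoint w (f w) → (∀ v ∈ V, Disjoint w (f v) ∧ Disjoint v (f w)) → w ∈ V)
    {y : D} (h₁ : ∀ v ∈ V.comapIso f, Disjoint y v) (h₂ : ∀ v ∈ V, Disjoint y v)
    (h₃ : ∀ v ∈ V.comapIso f.symm, Disjoint y v) : f y = y := by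
  have key : ∀ w ≤ y, Disjoint w (f w) → w = ⊥ := by
    intro w hwy hw
    have hwV : w ∈ V := by
      refine hmax w hw fun v hv ↦ ⟨(h₃ (f v) ?_).mono_left hwy, ?_⟩
      · rw [Order.Ideal.mem_comapIso]; simpa using hv
      · rw [← f.apply_symm_apply v, disjoint_map_orderIso_iff]
        refine ((h₁ _ ?_).mono_left hwy).symm
        rw [Order.Ideal.mem_comapIso]; simpa using hv
    exact disjoint_self.1 ((h₂ w hwV).mono_left hwy)
  apply le_antisymm
  · have := key (y \ f.symm y) sdiff_le (by
      simpa [map_sdiff'] using disjoint_sdiff_self_right.mono_left sdiff_le)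
    rw [sdiff_eq_bot_iff] at this
    simpa using f.monotone this
  · exact sdiff_eq_bot_iff.1 (key (y \ f y) sdiff_le
      (disjoint_sdiff_self_left.mono_right (f.monotone sdiff_le)))

theorem mk_orderIso_self_le {κ : Cardinal.{u}} (hκ : ℵ₀ ≤ κ) (h : #(BooleanSubalgebra D) ≤ κ) :
    #(D ≃o D) ≤ κ := by
  have hI := mk_ideal_le hκ h
  choose V hdisj hmax using exists_maximal_disjoint_ideal (D := D)
  let code : (D ≃o D) → (Order.Ideal D × Order.Ideal D × Order.Ideal D × Order.Ideal D) ×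
      (BooleanSubalgebra D × BooleanSubalgebra D × BooleanSubalgebra D) := fun f ↦
    (((V f).comapIso f, V f, (V f).comapIso f.symm, ((V f).comapIso f.symm).comapIso f.symm),
      (graphSubalgebra f ((V f).comapIso f), graphSubalgebra f (V f),
        graphSubalgebra f ((V f).comapIso f.symm)))
  have le_of_code : ∀ f g : D ≃o D, code f = code g → ∀ x, f x ≤ g x := by
    intro f g hfg x
    simp only [code, Prod.mk.injEq] at hfg
    obtain ⟨⟨e₁, e₂, e₃, e₄⟩, t₁, t₂, t₃⟩ := hfg
    have hg := hmax g
    rw [← e₁] at t₁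
    rw [← e₃] at t₃ e₄
    rw [← e₂] at e₁ e₃ t₂ hg
    have a₁ : ∀ v ∈ (V f).comapIso f, f v = g v := fun v hv ↦ by
      refine eqOn_of_graphSubalgebra_eq (fun y hy z hz ↦ ?_) ?_ t₁ hv
      · rw [← disjoint_map_orderIso_iff f]
        exact hdisj f _ hy _ hz
      · conv_rhs => rw [e₁]
        ext x
        simp [Order.Ideal.mem_comapIso]
    have a₂ : ∀ v ∈ V f, f v = g v := fun v hv ↦
      eqOn_of_graphSubalgebra_eq (hdisj f) e₃ t₂ hv
    have a₃ : ∀ v ∈ (V f).comapIso f.symm, f v = g v := fun v hv ↦ by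
      refine eqOn_of_graphSubalgebra_eq (fun y hy z hz ↦ ?_) e₄ t₃ hv
      rw [← disjoint_map_orderIso_iff f.symm, f.symm_apply_apply,
        ← f.apply_symm_apply z]
      exact hdisj f _ hy _ hz
    have hy : x \ f.symm (g x) = ⊥ := by
      set y := x \ f.symm (g x) with hy
      have hfy : Disjoint (f y) (g y) := by
        rw [hy, map_sdiff', f.apply_symm_apply]
        exact disjoint_sdiff_self_left.mono_right (g.monotone sdiff_le)
      have small : ∀ I : Order.Ideal D, (∀ v ∈ I, f v = g v) → ∀ v ∈ I, Disjoint y v := by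
        intro I hI v hv
        have h1 := hI (y ⊓ v) (I.lower inf_le_right hv)
        have h2 : Disjoint (f (y ⊓ v)) (g (y ⊓ v)) :=
          hfy.mono (f.monotone inf_le_left) (g.monotone inf_le_left)
        rw [← h1, disjoint_self, map_eq_bot_iff] at h2
        exact disjoint_iff.2 h2
      have s₁ := small _ a₁
      have s₂ := small _ a₂
      have s₃ := small _ a₃
      have hf1 : f y = y := apply_eq_self_of_disjoint (hmax f) s₁ s₂ s₃
      have hg1 : g y = y := apply_eq_self_of_disjoint hg (e₁ ▸ s₁) s₂ (e₃ ▸ s₃)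
      rw [hf1, hg1] at hfy
      exact disjoint_self.1 hfy
    have := f.monotone (sdiff_eq_bot_iff.1 hy)
    rwa [f.apply_symm_apply] at this
  have hinj : Injective code := fun f g hfg ↦ by
    ext x
    exact le_antisymm (le_of_code f g hfg x) (le_of_code g f hfg.symm x)
  have hm : ∀ {a b : Cardinal.{u}}, a ≤ κ → b ≤ κ → a * b ≤ κ := mul_le_of_le hκ
  refine (mk_le_of_injective hinj).trans ?_
  simp only [mk_prod, lift_id]
  exact hm (hm hI (hm hI (hm hI hI))) (hm h (hm h h))

theorem mk_orderIso_le_s7 {E : Type u} [BooleanAlgebra E] {κ : Cardinal.{u}} (hκ : ℵ₀ ≤ κ)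
    (h : #(BooleanSubalgebra D) ≤ κ) : #(D ≃o E) ≤ κ := by
  rcases isEmpty_or_nonempty (D ≃o E) with hE | ⟨⟨e⟩⟩
  · simp
  · refine (mk_le_of_injective (f := fun f : D ≃o E ↦ f.trans e.symm) fun f g hfg ↦ ?_).trans
      (mk_orderIso_self_le hκ h)
    ext x
    simpa using DFunLike.congr_fun hfg x

end Automorphisms

section Subdirect

theorem exists_orderIso_of_ker_eq {S Q Q' : Type*} [BooleanAlgebra S] [BooleanAlgebra Q]
    [BooleanAlgebra Q'] (u : BoundedLatticeHom S Q) (v : BoundedLatticeHom S Q')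
    (hu : Surjective u) (hv : Surjective v) (huv : ∀ s, u s = ⊥ ↔ v s = ⊥) :
    ∃ e : Q ≃o Q', ∀ s, e (u s) = v s := by
  have hle : ∀ s t, v s ≤ v t ↔ u s ≤ u t := fun s t ↦ by
    rw [← sdiff_eq_bot_iff, ← map_sdiff', ← huv, map_sdiff', sdiff_eq_bot_iff]
  have hF : ∀ s, v (surjInv hu (u s)) = v s := fun s ↦
    le_antisymm ((hle _ _).2 (surjInv_eq hu _).le) ((hle _ _).2 (surjInv_eq hu _).ge)
  let F : Q ↪o Q' := OrderEmbedding.ofMapLEIff (fun x ↦ v (surjInv hu x)) fun x y ↦ by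
    rw [hle, surjInv_eq hu, surjInv_eq hu]
  refine ⟨RelIso.ofSurjective F fun y ↦ ?_, hF⟩
  obtain ⟨s, rfl⟩ := hv y
  exact ⟨u s, hF s⟩

variable {A B C : Type u} [BooleanAlgebra A] [BooleanAlgebra B] [BooleanAlgebra C]

/-- The restriction of a homomorphism to a map from a subalgebra onto its image. -/
def BooleanSubalgebra.restrictHom (p : BoundedLatticeHom B A) (S : BooleanSubalgebra B)
    {L : BooleanSubalgebra A} (hL : S.map p = L) : BoundedLatticeHom S L where
  toFun s := ⟨p s, hL ▸ BooleanSubalgebra.mem_map_of_mem p s.2⟩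
  map_sup' s t := Subtype.ext (SupHomClass.map_sup p (s : B) t)
  map_inf' s t := Subtype.ext (InfHomClass.map_inf p (s : B) t)
  map_top' := Subtype.ext (TopHomClass.map_top p)
  map_bot' := Subtype.ext (BotHomClass.map_bot p)

theorem BooleanSubalgebra.restrictHom_surjective (p : BoundedLatticeHom B A)
    (S : BooleanSubalgebra B) {L : BooleanSubalgebra A} (hL : S.map p = L) :
    Surjective (S.restrictHom p hL) := by
  subst hL
  rintro ⟨_, s, hs, rfl⟩
  exact ⟨⟨s, hs⟩, rfl⟩

/-- The image under `p` of the elements of `S` killed by `q`. -/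
def BooleanSubalgebra.kerIdeal (p : BoundedLatticeHom B A) (q : BoundedLatticeHom B C)
    (S : BooleanSubalgebra B) {L : BooleanSubalgebra A} (hL : S.map p = L) : Order.Ideal L where
  carrier := {x | ∃ s ∈ S, q s = ⊥ ∧ p s = x}
  lower' := by
    subst hL
    rintro _ ⟨_, t, ht, rfl⟩ hle ⟨s, hs, hqs, hps⟩
    refine ⟨s ⊓ t, S.inf_mem hs ht, by simp [hqs], ?_⟩
    exact (InfHomClass.map_inf p s t).trans (hps ▸ inf_eq_right.2 hle)
  nonempty' := ⟨⊥, ⊥, S.bot_mem, BotHomClass.map_bot q, BotHomClass.map_bot p⟩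
  directed' := by
    rintro x ⟨s, hs, hqs, hps⟩ y ⟨t, ht, hqt, hpt⟩
    exact ⟨x ⊔ y, ⟨s ⊔ t, S.sup_mem hs ht, by simp [hqs, hqt], by simp [hps, hpt]⟩,
      le_sup_left, le_sup_right⟩

theorem BooleanSubalgebra.mem_kerIdeal_iff_swap (p : BoundedLatticeHom B A)
    (q : BoundedLatticeHom B C) (S : BooleanSubalgebra B) {L : BooleanSubalgebra A}
    {M : BooleanSubalgebra C} (hL : S.map p = L) (hM : S.map q = M) (s : S) :
    S.restrictHom p hL s ∈ S.kerIdeal p q hL ↔ S.restrictHom q hM s ∈ S.kerIdeal q p hM := by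
  constructor <;>
  · rintro ⟨t, ht, h1, h2⟩
    refine ⟨s \ t, S.sdiff_mem s.2 ht, ?_, ?_⟩
    · rw [map_sdiff', h2]
      exact sdiff_self
    · rw [map_sdiff', h1, sdiff_bot]
      rfl

/-- Subalgebras of a subdirect product are counted by the subalgebras of the factors. -/
theorem mk_booleanSubalgebra_le_of_subdirect (p : BoundedLatticeHom B A)
    (q : BoundedLatticeHom B C) (hpq : ∀ x y, p x = p y → q x = q y → x = y)
    {κ : Cardinal.{u}} (hκ : ℵ₀ ≤ κ) (hA : #(BooleanSubalgebra A) ≤ κ)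
    (hC : #(BooleanSubalgebra C) ≤ κ) : #(BooleanSubalgebra B) ≤ κ := by
  have hm : ∀ {a b : Cardinal.{u}}, a ≤ κ → b ≤ κ → a * b ≤ κ := mul_le_of_le hκ
  refine (mk_le_mk_mul_of_mk_preimage_le (c := κ)
    (fun S : BooleanSubalgebra B ↦ (S.map p, S.map q)) ?_).trans
    (hm (by simpa using hm hA hC) le_rfl)
  rintro ⟨L, M⟩
  have hLκ : #(BooleanSubalgebra L) ≤ κ :=
    (mk_booleanSubalgebra_le_of_injective L.subtype L.subtype_injective).trans hA
  have hMκ : #(BooleanSubalgebra M) ≤ κ :=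
    (mk_booleanSubalgebra_le_of_injective M.subtype M.subtype_injective).trans hC
  have hp : ∀ S : (fun S : BooleanSubalgebra B ↦ (S.map p, S.map q)) ⁻¹' {(L, M)},
      S.1.map p = L := fun S ↦ congrArg Prod.fst S.2
  have hq : ∀ S : (fun S : BooleanSubalgebra B ↦ (S.map p, S.map q)) ⁻¹' {(L, M)},
      S.1.map q = M := fun S ↦ congrArg Prod.snd S.2
  refine (mk_le_mk_mul_of_mk_preimage_le (c := κ)
    (fun S ↦ (S.1.kerIdeal p q (hp S), S.1.kerIdeal q p (hq S))) ?_).trans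
    (hm (by simpa using hm (mk_ideal_le hκ hLκ) (mk_ideal_le hκ hMκ)) le_rfl)
  rintro ⟨I, J⟩
  obtain ⟨Q, _, π, hπ, hπI⟩ := exists_quotient I
  obtain ⟨Q', _, π', hπ', hπJ⟩ := exists_quotient J
  have hI : ∀ x, π x = ⊥ ↔ x ∈ I := fun x ↦ by
    simpa using hπI x ⊥
  have hJ : ∀ x, π' x = ⊥ ↔ x ∈ J := fun x ↦ by
    simpa using hπJ x ⊥
  have hiso : ∀ S : (fun S : (fun S : BooleanSubalgebra B ↦ (S.map p, S.map q)) ⁻¹' {(L, M)} ↦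
      (S.1.kerIdeal p q (hp S), S.1.kerIdeal q p (hq S))) ⁻¹' {(I, J)},
      ∃ e : Q ≃o Q', ∀ s : S.1.1,
        e (π (S.1.1.restrictHom p (hp S.1) s)) = π' (S.1.1.restrictHom q (hq S.1) s) := by
    intro S
    have hSI : ∀ x, x ∈ S.1.1.kerIdeal p q (hp S.1) ↔ x ∈ I :=
      SetLike.ext_iff.1 (congrArg Prod.fst S.2)
    have hSJ : ∀ x, x ∈ S.1.1.kerIdeal q p (hq S.1) ↔ x ∈ J :=
      SetLike.ext_iff.1 (congrArg Prod.snd S.2)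
    refine exists_orderIso_of_ker_eq (π.comp (S.1.1.restrictHom p (hp S.1)))
      (π'.comp (S.1.1.restrictHom q (hq S.1)))
      (hπ.comp (BooleanSubalgebra.restrictHom_surjective _ _ _))
      (hπ'.comp (BooleanSubalgebra.restrictHom_surjective _ _ _)) fun s ↦ ?_
    rw [BoundedLatticeHom.comp_apply, BoundedLatticeHom.comp_apply, hI, hJ, ← hSI, ← hSJ]
    exact BooleanSubalgebra.mem_kerIdeal_iff_swap p q _ _ _ s
  choose e he using hiso
  have hle : ∀ S T, e S = e T → S.1.1 ≤ T.1.1 := by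
    intro S T hST s hs
    have hTJ : ∀ x, x ∈ T.1.1.kerIdeal q p (hq T.1) ↔ x ∈ J :=
      SetLike.ext_iff.1 (congrArg Prod.snd T.2)
    obtain ⟨t, ht⟩ := T.1.1.restrictHom_surjective p (hp T.1)
      (S.1.1.restrictHom p (hp S.1) ⟨s, hs⟩)
    have h1 : π' (T.1.1.restrictHom q (hq T.1) t) = π' (S.1.1.restrictHom q (hq S.1) ⟨s, hs⟩) := by
      rw [← he, ← he, ht, hST]
    rw [hπJ, ← hTJ] at h1
    obtain ⟨j, hj, hpj, hqj⟩ := h1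
    have hpt : p t = p s := congrArg Subtype.val ht
    have hqj' : q j = q t ∆ q s := hqj
    have hs' : s = (t : B) ∆ j := by
      apply hpq
      · rw [map_symmDiff', hpj, hpt, symmDiff_bot]
      · rw [map_symmDiff', hqj', symmDiff_symmDiff_cancel_left]
    rw [hs', symmDiff_def]
    exact T.1.1.sup_mem (T.1.1.sdiff_mem t.2 hj) (T.1.1.sdiff_mem hj t.2)
  have hinj : Injective e := fun S T hST ↦
    Subtype.ext (Subtype.ext (le_antisymm (hle S T hST) (hle T S hST.symm)))
  have hQ := (mk_booleanSubalgebra_le_of_surjective π hπ).trans hLκ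
  exact (mk_le_of_injective hinj).trans (mk_orderIso_le_s7 hκ hQ)

end Subdirect

section Relative

variable {B : Type u} [BooleanAlgebra B]

/-- The relative Boolean algebra of elements below `a`. -/
instance Set.Iic.instBooleanAlgebra (a : B) : BooleanAlgebra (Set.Iic a) where
  __ := (inferInstance : Lattice (Set.Iic a))
  __ := (inferInstance : BoundedOrder (Set.Iic a))
  le_sup_inf x y z := le_sup_inf (x := (x : B)) (y := y) (z := z)
  compl x := ⟨a \ x, sdiff_le⟩
  inf_compl_le_bot x := (inf_sdiff_self_right (x := (x : B)) (y := a)).le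
  top_le_sup_compl x := (sup_sdiff_cancel_right x.2).ge

/-- The projection `x ↦ x ⊓ a` onto the relative algebra below `a`. -/
def relProj (a : B) : BoundedLatticeHom B (Set.Iic a) where
  toFun x := ⟨x ⊓ a, inf_le_right⟩
  map_sup' x y := Subtype.ext (inf_sup_right x y a)
  map_inf' x y := Subtype.ext (inf_inf_distrib_right x y a)
  map_top' := Subtype.ext (top_inf_eq a)
  map_bot' := Subtype.ext (bot_inf_eq a)

theorem relProj_surjective (a : B) : Surjective (relProj a) := fun x ↦
  ⟨x, Subtype.ext (inf_eq_left.2 x.2)⟩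

theorem relProj_jointly_injective (a x y : B) (h : relProj a x = relProj a y)
    (h' : relProj aᶜ x = relProj aᶜ y) : x = y := by
  have h1 : x ⊓ a = y ⊓ a := congrArg Subtype.val h
  have h2 : x ⊓ aᶜ = y ⊓ aᶜ := congrArg Subtype.val h'
  rw [← sup_inf_inf_compl (x := x) (y := a), h1, h2, sup_inf_inf_compl]

/-- Relative subalgebras are the subalgebras of the relative algebra. -/
def relSubalgEquiv (a : B) : {S : Set B // IsRelSubalg a S} ≃ BooleanSubalgebra (Set.Iic a) where
  toFun S :=
    { carrier := {x | (x : B) ∈ S.1}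
      supClosed' := fun x hx y hy ↦ S.2.2.2.2.1 x hx y hy
      infClosed' := fun x hx y hy ↦ S.2.2.2.2.2.1 x hx y hy
      compl_mem' := fun {x} hx ↦ S.2.2.2.2.2.2 x hx
      bot_mem' := S.2.2.1 }
  invFun L := ⟨Subtype.val '' (L : Set (Set.Iic a)), by
    refine ⟨?_, ⟨⊥, L.bot_mem, rfl⟩, ⟨⊤, L.top_mem, rfl⟩, ?_, ?_, ?_⟩
    · rintro _ ⟨x, -, rfl⟩
      exact x.2
    · rintro _ ⟨x, hx, rfl⟩ _ ⟨y, hy, rfl⟩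
      exact ⟨x ⊔ y, L.sup_mem hx hy, rfl⟩
    · rintro _ ⟨x, hx, rfl⟩ _ ⟨y, hy, rfl⟩
      exact ⟨x ⊓ y, L.inf_mem hx hy, rfl⟩
    · rintro _ ⟨x, hx, rfl⟩
      exact ⟨xᶜ, L.compl_mem hx, rfl⟩⟩
  left_inv S := Subtype.ext (Subtype.image_preimage_val _ _ |>.trans
    (Set.inter_eq_right.2 fun x hx ↦ S.2.1 x hx))
  right_inv L := SetLike.coe_injective (Set.preimage_image_eq _ Subtype.val_injective)

theorem mk_relSubalg_top : #{S : Set B // IsRelSubalg ⊤ S} = #(BooleanSubalgebra B) := by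
  rw [mk_congr (relSubalgEquiv ⊤)]
  refine le_antisymm (mk_booleanSubalgebra_le_of_surjective _ (relProj_surjective ⊤))
    (mk_booleanSubalgebra_le_of_injective (relProj ⊤) fun x y h ↦ ?_)
  simpa [relProj] using h

end Relative

/-- For an infinite Boolean algebra `B` and `0 < a < 1`, the number of
subalgebras of `B` is the maximum of the numbers of subalgebras of
`B ↾ a` and `B ↾ (1 - a)`. -/
theorem stmt_7 {B : Type*} [BooleanAlgebra B] [Infinite B] (a : B)
    (h0 : ⊥ < a) (h1 : a < ⊤) :
    Cardinal.mk {S : Set B // IsRelSubalg (⊤ : B) S} =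
      max (Cardinal.mk {S : Set B // IsRelSubalg a S})
        (Cardinal.mk {S : Set B // IsRelSubalg aᶜ S}) := by
  rw [mk_relSubalg_top, mk_congr (relSubalgEquiv a), mk_congr (relSubalgEquiv aᶜ)]
  apply le_antisymm
  · refine mk_booleanSubalgebra_le_of_subdirect (relProj a) (relProj aᶜ)
      (relProj_jointly_injective a) ?_ (le_max_left _ _) (le_max_right _ _)
    have hinf : Infinite (Set.Iic a) ∨ Infinite (Set.Iic aᶜ) := by
      by_contra! h
      obtain ⟨_, _⟩ := h
      refine not_finite_iff_infinite.2 ‹Infinite B› (Finite.of_injective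
        (fun x ↦ (relProj a x, relProj aᶜ x)) fun x y hxy ↦ ?_)
      simp only [Prod.mk.injEq] at hxy
      exact relProj_jointly_injective a x y hxy.1 hxy.2
    rcases hinf with h | h
    · exact (aleph0_le_mk_booleanSubalgebra _).trans (le_max_left _ _)
    · exact (aleph0_le_mk_booleanSubalgebra _).trans (le_max_right _ _)
  · exact max_le (mk_booleanSubalgebra_le_of_surjective _ (relProj_surjective a))
      (mk_booleanSubalgebra_le_of_surjective _ (relProj_surjective aᶜ))
end

section
/- Let B be an infinite Boolean algebra and define w⁺(B) = sup{|A|⁺ : A ⊆ B a set of pairwise incomparable elements}. Then w⁺(B) is an uncountable regular cardinal. -/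
open Cardinal Order Set

theorem Cardinal.aleph0_le_cof_ord {l : Cardinal.{u}} (h0 : ℵ₀ ≤ l) : ℵ₀ ≤ l.ord.cof :=
  Ordinal.aleph0_le_cof_iff.2 (Ordinal.one_lt_cof_iff.2 (isSuccLimit_ord h0))

theorem Cardinal.succ_max_aleph0_lt_of_singular {l m : Cardinal.{u}} (h0 : ℵ₀ ≤ l)
    (hl : l.ord.cof < l) (hm : m < l) : succ (max m ℵ₀) < l := by
  refine lt_of_le_of_ne
    (succ_le_of_lt (max_lt hm ((aleph0_le_cof_ord h0).trans_lt hl))) fun h => ?_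
  have hr := isRegular_succ (le_max_right m ℵ₀)
  rw [h] at hr
  exact hl.ne hr.cof_ord

theorem Cardinal.exists_cofinal_family (l : Cardinal.{u}) :
    ∃ f : l.ord.cof.ord.ToType → Cardinal.{u}, (∀ i, f i < l) ∧ ∀ m < l, ∃ i, m ≤ f i := by
  obtain ⟨s, hs, hcard⟩ := Order.exists_cof_eq l.ord.ToType
  rw [Ordinal.cof_toType] at hcard
  obtain ⟨e⟩ : Nonempty (l.ord.cof.ord.ToType ≃ s) := by
    rw [← Cardinal.eq, hcard, mk_ord_toType]
  refine ⟨fun i => #(Iio (e i).1), fun i => by simpa using mk_Iio_lt (e i).1 (by simp), fun m hm => ?_⟩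
  have hm' : m.ord < l.ord := ord_lt_ord.2 hm
  have hm'' : m.ord < Ordinal.type (α := l.ord.ToType) (· < ·) := by simpa using hm'
  obtain ⟨b, hb, hab⟩ := hs (Ordinal.enum (α := l.ord.ToType) (· < ·) ⟨m.ord, hm''⟩)
  refine ⟨e.symm ⟨b, hb⟩, ?_⟩
  have hcard := congrArg Ordinal.card
    (Ordinal.typein_enum (α := l.ord.ToType) (· < ·) hm'')
  rw [Ordinal.card_typein, card_ord] at hcard
  simpa using hcard.ge.trans (mk_le_mk_of_subset (Iio_subset_Iio hab))

theorem Cardinal.mk_iUnion_lt_of_lt_cof {α ι : Type u} {l : Cardinal.{u}} (h0 : ℵ₀ ≤ l)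
    (hι : #ι < l.ord.cof) {s : ι → Set α} (hs : ∀ i, #(s i) < l) : #(⋃ i, s i) < l :=
  (mk_iUnion_le s).trans_lt
    (mul_lt_of_lt h0 (hι.trans_le (Ordinal.cof_ord_le l)) (iSup_lt_of_lt_cof_ord hι hs))

theorem Cardinal.exists_forall_mem_lt_of_mk_lt_cof {α : Type u} [LinearOrder α] (s : Set α)
    (hs : #s < Order.cof α) : ∃ k, ∀ x ∈ s, x < k := by
  have h : ¬ IsCofinal s := fun h => (Order.cof_le h).not_gt hs
  simpa [IsCofinal] using h

theorem Cardinal.exists_map_forall_le_mk_fiber {α K : Type u} [Nonempty K] {T : Set α}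
    (hT : ℵ₀ ≤ #T) (hK : #K ≤ #T) : ∃ g : α → K, ∀ k, #T ≤ #{x | x ∈ T ∧ g x = k} := by
  classical
  obtain ⟨e⟩ : Nonempty (T ≃ K × T) := by
    rw [← Cardinal.eq, mk_prod, lift_id, lift_id, mul_eq_right hT hK (mk_ne_zero K)]
  refine ⟨fun x => if h : x ∈ T then (e ⟨x, h⟩).1 else Classical.arbitrary K, fun k => ?_⟩
  refine mk_le_of_injective (f := fun x => ⟨(e.symm (k, x)).1, (e.symm (k, x)).2, by simp⟩) ?_
  intro x y hxy
  simpa [Subtype.val_inj] using hxy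

theorem IsAntichain.exists_large_piece {α : Type u} [PartialOrder α] {l : Cardinal.{u}}
    (h0 : ℵ₀ ≤ l) (hl : l.ord.cof < l) {P : Set α} {N : α → Set α} (hN : ∀ x ∈ P, #(N x) < l)
    (hP : ∀ m < l, ∃ A ⊆ P, IsAntichain (· ≤ ·) A ∧ m ≤ #A)
    {U : Set α} (hU : #U < l) {m : Cardinal.{u}} (hm : m < l)
    {G : α → Set (succ l.ord.cof).ord.ToType} (hG : ∀ y ∈ P, #(G y) ≤ l.ord.cof) :
    ∃ T ⊆ P, IsAntichain (· ≤ ·) T ∧ #(⋃ x ∈ T, N x) < l ∧ (∀ x ∈ T, x ∉ U) ∧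
      (∃ k₀, ∀ y ∈ T, ∀ k ∈ G y, k < k₀) ∧
      ∃ g : α → (succ l.ord.cof).ord.ToType, ∀ k, m ≤ #{x | x ∈ T ∧ g x = k} := by
  have hreg := isRegular_succ (aleph0_le_cof_ord h0)
  obtain ⟨f, hfl, hf⟩ := exists_cofinal_family l
  have hκ : succ l.ord.cof < l := by
    simpa [max_eq_left (aleph0_le_cof_ord h0)] using succ_max_aleph0_lt_of_singular h0 hl hl
  set ν := succ (max (max #U (max m (succ l.ord.cof))) ℵ₀) with hν
  have hνl : ν < l := succ_max_aleph0_lt_of_singular h0 hl (max_lt hU (max_lt hm hκ))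
  have hνreg : ν.IsRegular := isRegular_succ (le_max_right _ _)
  have hlt : max (max #U (max m (succ l.ord.cof))) ℵ₀ < ν := lt_succ _
  simp only [max_lt_iff] at hlt
  obtain ⟨⟨hUν, hmν, hκν⟩, h0ν⟩ := hlt
  obtain ⟨A, hAP, hA, hνA⟩ := hP ν hνl
  have hAU : ν ≤ #(A \ U : Set α) := by
    by_contra! h
    exact ((hνA.trans (le_mk_sdiff_add_mk A U)).trans_lt (add_lt_of_lt h0ν.le h hUν)).false
  have hb : ∀ y : (A \ U : Set α), ∃ p : l.ord.cof.ord.ToType × (succ l.ord.cof).ord.ToType,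
      #(N y) ≤ f p.1 ∧ ∀ k ∈ G y, k < p.2 := by
    intro y
    obtain ⟨i, hi⟩ := hf _ (hN y (hAP y.2.1))
    obtain ⟨k, hk⟩ := exists_forall_mem_lt_of_mk_lt_cof (G y) (by
      rw [Ordinal.cof_toType, hreg.cof_ord]
      exact (hG y (hAP y.2.1)).trans_lt (lt_succ _))
    exact ⟨(i, k), hi, hk⟩
  choose p hp using hb
  obtain ⟨a, t, htA, hνt, ht⟩ := infinite_pigeonhole_set p ν hAU h0ν.le (by
    rw [hνreg.cof_ord, mk_prod, lift_id, lift_id, mk_ord_toType, mk_ord_toType]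
    exact mul_lt_of_lt h0ν.le ((lt_succ _).trans hκν) hκν)
  obtain ⟨T, hTt, hTν⟩ := le_mk_iff_exists_subset.1 hνt
  have hTA := hTt.trans htA
  have : Nonempty (succ l.ord.cof).ord.ToType := ⟨a.2⟩
  obtain ⟨g, hg⟩ := exists_map_forall_le_mk_fiber (K := (succ l.ord.cof).ord.ToType) (T := T)
    (by rw [hTν]; exact h0ν.le) (by rw [hTν, mk_ord_toType]; exact hκν.le)
  refine ⟨T, fun x hx => hAP (hTA hx).1, hA.subset fun x hx => (hTA hx).1, ?_,
    fun x hx => (hTA hx).2, ⟨a.2, fun y hy k hk => ?_⟩, g, fun k => ?_⟩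
  · refine (mk_biUnion_le N T).trans_lt (mul_lt_of_lt h0 (hTν.trans_lt hνl) ?_)
    refine (ciSup_le' fun x => ?_).trans_lt (hfl a.1)
    rw [← ht (hTt x.2)]
    exact (hp _).1
  · rw [← ht (hTt hy)]
    exact (hp ⟨y, hTA hy⟩).2 k hk
  · exact hmν.le.trans (hTν.ge.trans (hg k))

/-- A free set theorem for a singular cardinal `l`: if comparability on `P` is covered by a relation
`y ∈ N x` with fewer than `l` values `y` for each `x` and a relation `x ∈ F y` with at most `cof l`
values `x` for each `y`, and `P` contains antichains of all sizes below `l`, then there is an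
antichain of size `l`. -/
theorem IsAntichain.exists_of_singular {α : Type u} [PartialOrder α] {l : Cardinal.{u}}
    (h0 : ℵ₀ ≤ l) (hl : l.ord.cof < l) {P : Set α} {N F : α → Set α}
    (hN : ∀ x ∈ P, #(N x) < l) (hF : ∀ y ∈ P, #(F y) ≤ l.ord.cof)
    (hNF : ∀ x ∈ P, ∀ y ∈ P, x ≤ y ∨ y ≤ x → y ∈ N x ∨ x ∈ F y)
    (hP : ∀ m < l, ∃ A ⊆ P, IsAntichain (· ≤ ·) A ∧ m ≤ #A) :
    ∃ A : Set α, IsAntichain (· ≤ ·) A ∧ l ≤ #A := by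
  have hω := aleph0_le_cof_ord h0
  have hreg := isRegular_succ hω
  obtain ⟨f, hfl, hf⟩ := exists_cofinal_family l
  let D := {d : Set α × (α → (succ l.ord.cof).ord.ToType) // #(⋃ x ∈ d.1, N x) < l}
  have step : ∀ (i : l.ord.cof.ord.ToType) (prev : ∀ j, j < i → D), ∃ d : D,
      d.1.1 ⊆ P ∧ IsAntichain (· ≤ ·) d.1.1 ∧
      (∀ j (hj : j < i), ∀ x ∈ (prev j hj).1.1, ∀ y ∈ d.1.1, y ∉ N x) ∧
      (∃ k₀, ∀ j (hj : j < i), ∀ x ∈ (prev j hj).1.1, ∀ y ∈ d.1.1, x ∈ F y →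
        (prev j hj).1.2 x < k₀) ∧
      ∀ k, f i ≤ #{x | x ∈ d.1.1 ∧ d.1.2 x = k} := by
    intro i prev
    have hi : #(Iio i) < l.ord.cof  := by
      simpa using mk_Iio_lt i (by simp)
    obtain ⟨T, hTP, hT, hTN, hTU, ⟨k₀, hk₀⟩, g, hg⟩ := exists_large_piece h0 hl hN hP
      (U := ⋃ j : Iio i, ⋃ x ∈ (prev j.1 j.2).1.1, N x)
      (mk_iUnion_lt_of_lt_cof h0 hi fun j => (prev j.1 j.2).2) (hfl i)
      (G := fun y => ⋃ j : Iio i, (prev j.1 j.2).1.2 '' F y) (fun y hy => by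
        refine (mk_iUnion_le _).trans ((mul_le_mul' hi.le (ciSup_le' fun j =>
          mk_image_le.trans (hF y hy))).trans (mul_eq_self hω).le))
    refine ⟨⟨(T, g), hTN⟩, hTP, hT, fun j hj x hx y hy hyx => hTU y hy ?_,
      ⟨k₀, fun j hj x hx y hy hxy => hk₀ y hy _ ?_⟩, hg⟩
    · simp only [mem_iUnion]
      exact ⟨⟨j, hj⟩, x, hx, hyx⟩
    · simp only [mem_iUnion]
      exact ⟨⟨j, hj⟩, x, hxy, rfl⟩
  choose next hnext using step
  let d : l.ord.cof.ord.ToType → D := WellFounded.fix wellFounded_lt next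
  have hd : ∀ i, d i = next i fun j _ => d j := fun i => WellFounded.fix_eq _ _ _
  have hd' := fun i => hnext i fun j _ => d j
  simp only [← hd] at hd'
  choose hdP hdA hdN hdk hdf using hd'
  choose k₀ hk₀ using hdk
  obtain ⟨k, hk⟩ := exists_forall_mem_lt_of_mk_lt_cof (range k₀) (by
    rw [Ordinal.cof_toType, hreg.cof_ord]
    exact mk_range_le.trans_lt (by simp))
  have key : ∀ i j, j < i → ∀ x ∈ (d j).1.1, (d j).1.2 x = k → ∀ y ∈ (d i).1.1,
      ¬ (x ≤ y ∨ y ≤ x) := by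
    intro i j hj x hx hxk y hy hxy
    rcases hNF x (hdP j hx) y (hdP i hy) hxy with h | h
    · exact hdN i j hj x hx y hy h
    · exact ((hk₀ i j hj x hx y hy h).trans (hk _ (mem_range_self i))).ne hxk
  refine ⟨⋃ i, {x | x ∈ (d i).1.1 ∧ (d i).1.2 x = k}, ?_, ?_⟩
  · intro x hx y hy hne hxy
    obtain ⟨i, hx, hxk⟩ := mem_iUnion.1 hx
    obtain ⟨j, hy, hyk⟩ := mem_iUnion.1 hy
    rcases lt_trichotomy i j with h | rfl | h
    · exact key j i h x hx hxk y hy (.inl hxy)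
    · exact hdA i hx hy hne hxy
    · exact key i j h y hy hyk x hx (.inr hxy)
  · refine le_of_forall_lt fun m hm => ?_
    obtain ⟨i, hi⟩ := hf _ (succ_max_aleph0_lt_of_singular h0 hl hm)
    refine ((le_max_left m ℵ₀).trans_lt (lt_succ _)).trans_le (hi.trans ((hdf i k).trans ?_))
    exact mk_le_mk_of_subset (subset_iUnion (fun i => {x | x ∈ (d i).1.1 ∧ (d i).1.2 x = k}) i)

theorem exists_infinite_antichain (B : Type u) [BooleanAlgebra B] [Infinite B] :
    ∃ A : Set B, IsAntichain (· ≤ ·) A ∧ ℵ₀ ≤ #A := by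
  have of_disjoint : ∀ d : ℕ → B, (∀ n, d n ≠ ⊥) → (∀ m n, m < n → Disjoint (d m) (d n)) →
      ∃ A : Set B, IsAntichain (· ≤ ·) A ∧ ℵ₀ ≤ #A := by
    intro d hd hdisj
    have hsymm : ∀ m n, m ≠ n → Disjoint (d m) (d n) := fun m n hmn =>
      hmn.lt_or_gt.elim (hdisj m n) fun h => (hdisj n m h).symm
    have hle : ∀ m n, d m ≤ d n → m = n := fun m n h => by
      by_contra hmn
      exact hd m ((hsymm m n hmn).eq_bot_of_le h)
    refine ⟨range d, ?_, ?_⟩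
    · rintro _ ⟨m, rfl⟩ _ ⟨n, rfl⟩ hne h
      exact hne (congrArg d (hle m n h))
    · exact infinite_coe_iff.2 (infinite_range_of_injective fun m n h => hle m n h.le) |>
        aleph0_le_mk_iff.2
  let e := Infinite.natEmbedding B
  obtain ⟨g, hg | hg⟩ := exists_increasing_or_nonincreasing_subseq (· < ·) e
  · refine of_disjoint (fun n => e (g (n + 1)) \ e (g n))
      (fun n h => (hg n (n + 1) n.lt_succ_self).not_ge (sdiff_eq_bot_iff.1 h)) fun m n hmn => ?_
    have h : e (g (m + 1)) ≤ e (g n) := by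
      rcases (Nat.succ_le_of_lt hmn).eq_or_lt with h | h
      · rw [← h]
      · exact (hg _ _ h).le
    exact disjoint_sdiff_self_right.mono_left (sdiff_le.trans h)
  obtain ⟨g', hg' | hg'⟩ := exists_increasing_or_nonincreasing_subseq (· > ·) (e ∘ g)
  · refine of_disjoint (fun n => e (g (g' n)) \ e (g (g' (n + 1))))
      (fun n h => (hg' n (n + 1) n.lt_succ_self).not_ge (sdiff_eq_bot_iff.1 h)) fun m n hmn => ?_
    have h : e (g (g' n)) ≤ e (g (g' (m + 1))) := by
      rcases (Nat.succ_le_of_lt hmn).eq_or_lt with h | h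
      · rw [← h]
      · exact (hg' _ _ h).le
    exact disjoint_sdiff_self_left.mono_right (sdiff_le.trans h)
  · have hinj : Function.Injective fun n => e (g (g' n)) :=
      e.injective.comp (g.injective.comp g'.injective)
    refine ⟨range fun n => e (g (g' n)), ?_, ?_⟩
    · rintro _ ⟨m, rfl⟩ _ ⟨n, rfl⟩ hne h
      have hlt := lt_of_le_of_ne h hne
      rcases lt_trichotomy m n with hmn | rfl | hmn
      · exact hg _ _ (g'.strictMono hmn) hlt
      · exact hne rfl
      · exact hg' _ _ hmn hlt
    · exact aleph0_le_mk_iff.2 (infinite_coe_iff.2 (infinite_range_of_injective hinj))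

/-- An antichain of size `cof l` below `x`, together with arbitrarily large antichains of size
less than `l` below `xᶜ`, yields an antichain of size `l`. -/
theorem IsAntichain.exists_of_Iic_compl {B : Type u} [BooleanAlgebra B] {l : Cardinal.{u}}
    (h0 : ℵ₀ ≤ l) (hl : l.ord.cof < l) {x : B} {C : Set B} (hC : IsAntichain (· ≤ ·) C)
    (hCx : C ⊆ Iic x) (hcof : l.ord.cof ≤ #C)
    (hx : ∀ m < l, ∃ A ⊆ Iic xᶜ, IsAntichain (· ≤ ·) A ∧ m ≤ #A) :
    ∃ A : Set B, IsAntichain (· ≤ ·) A ∧ l ≤ #A := by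
  obtain ⟨f, hfl, hf⟩ := exists_cofinal_family l
  obtain ⟨e⟩ : Nonempty (l.ord.cof.ord.ToType ↪ C) := by
    rwa [← Cardinal.le_def, mk_ord_toType]
  choose A hAx hA hfA using fun i => hx (f i) (hfl i)
  have key : ∀ c ≤ x, ∀ c' ≤ x, ∀ a ≤ xᶜ, ∀ a' ≤ xᶜ, c ⊔ a ≤ c' ⊔ a' → c ≤ c' ∧ a ≤ a' := by
    intro c hc c' hc' a ha a' ha' h
    constructor
    · exact Disjoint.left_le_of_le_sup_right (le_sup_left.trans h) (disjoint_compl_right.mono hc ha')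
    · exact Disjoint.left_le_of_le_sup_left (le_sup_right.trans h) (disjoint_compl_left.mono ha hc')
  refine ⟨⋃ i, (fun a => (e i : B) ⊔ a) '' A i, ?_, le_of_forall_lt fun m hm => ?_⟩
  · intro y hy z hz hne hyz
    obtain ⟨i, a, ha, rfl⟩ := mem_iUnion.1 hy
    obtain ⟨j, b, hb, rfl⟩ := mem_iUnion.1 hz
    obtain ⟨h₁, h₂⟩ := key _ (hCx (e i).2) _ (hCx (e j).2) a (hAx i ha) b (hAx j hb) hyz
    obtain rfl : i = j := e.injective (Subtype.ext (hC.eq (e i).2 (e j).2 h₁))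
    exact hne (congrArg _ ((hA i).eq ha hb h₂))
  · obtain ⟨i, hi⟩ := hf _ (succ_max_aleph0_lt_of_singular h0 hl hm)
    refine ((le_max_left m ℵ₀).trans_lt (lt_succ _)).trans_le (hi.trans ((hfA i).trans ?_))
    refine le_trans ?_ (mk_le_mk_of_subset
      (subset_iUnion (fun i => (fun a => (e i : B) ⊔ a) '' A i) i))
    refine (mk_image_eq_of_injOn _ _ fun a ha b hb hab => ?_).ge
    exact le_antisymm (key _ (hCx (e i).2) _ (hCx (e i).2) a (hAx i ha) b (hAx i hb) hab.le).2
      (key _ (hCx (e i).2) _ (hCx (e i).2) b (hAx i hb) a (hAx i ha) hab.ge).2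

/-- A set with antichains of all sizes below `l` contains a union of `cof l` many antichains with the
same property. -/
theorem IsAntichain.exists_subset_mk_inter_le {α : Type u} [PartialOrder α] {l : Cardinal.{u}}
    {Q : Set α} (hQ : ∀ m < l, ∃ A ⊆ Q, IsAntichain (· ≤ ·) A ∧ m ≤ #A) :
    ∃ P ⊆ Q, (∀ m < l, ∃ A ⊆ P, IsAntichain (· ≤ ·) A ∧ m ≤ #A) ∧
      ∀ (S : Set α) (c : Cardinal.{u}), (∀ A ⊆ S, IsAntichain (· ≤ ·) A → #A ≤ c) →
        #(P ∩ S : Set α) ≤ l.ord.cof * c := by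
  obtain ⟨f, hfl, hf⟩ := exists_cofinal_family l
  choose A hAQ hA hfA using fun i => hQ (f i) (hfl i)
  refine ⟨⋃ i, A i, iUnion_subset hAQ, fun m hm => ?_, fun S c hS => ?_⟩
  · obtain ⟨i, hi⟩ := hf m hm
    exact ⟨A i, subset_iUnion A i, hA i, hi.trans (hfA i)⟩
  · rw [iUnion_inter]
    refine (mk_iUnion_le _).trans (mul_le_mul' (by simp) (ciSup_le' fun i => ?_))
    exact hS _ inter_subset_right ((hA i).subset inter_subset_left)

theorem IsAntichain.exists_of_singular_of_union {α : Type u} [PartialOrder α]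
    {l : Cardinal.{u}} (h0 : ℵ₀ ≤ l) (hl : l.ord.cof < l) {Q R : Set α}
    (hQR : ∀ m < l, ∃ A ⊆ Q ∪ R, IsAntichain (· ≤ ·) A ∧ m ≤ #A) :
    (∀ m < l, ∃ A ⊆ Q, IsAntichain (· ≤ ·) A ∧ m ≤ #A) ∨
      ∀ m < l, ∃ A ⊆ R, IsAntichain (· ≤ ·) A ∧ m ≤ #A := by
  by_contra! h
  obtain ⟨⟨m, hm, hmQ⟩, ⟨n, hn, hnR⟩⟩ := h
  obtain ⟨A, hAQR, hA, hle⟩ := hQR _ (succ_max_aleph0_lt_of_singular h0 hl (max_lt hm hn))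
  have hQ := hmQ _ inter_subset_right (hA.subset (inter_subset_left (t := Q)))
  have hR := hnR _ inter_subset_right (hA.subset (inter_subset_left (t := R)))
  have hsum : #A ≤ #(A ∩ Q : Set α) + #(A ∩ R : Set α) := by
    refine le_trans (mk_le_mk_of_subset ?_) (mk_union_le _ _)
    rw [← inter_union_distrib_left]
    exact subset_inter subset_rfl hAQR
  have hlt := lt_succ (max (max m n) ℵ₀)
  refine (hle.trans (hsum.trans ?_)).not_gt hlt
  refine add_le_of_le (le_max_right _ _) ?_ ?_
  · exact hQ.le.trans ((le_max_left _ _).trans (le_max_left _ _))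
  · exact hR.le.trans ((le_max_right _ _).trans (le_max_left _ _))

/-- A Boolean algebra whose width is a singular cardinal attains its width. -/
theorem BooleanAlgebra.exists_antichain_of_singular {B : Type u} [BooleanAlgebra B]
    {l : Cardinal.{u}} (h0 : ℵ₀ ≤ l) (hl : l.ord.cof < l)
    (hB : ∀ m < l, ∃ A : Set B, IsAntichain (· ≤ ·) A ∧ m ≤ #A) :
    ∃ A : Set B, IsAntichain (· ≤ ·) A ∧ l ≤ #A := by
  by_contra hno
  have hω := aleph0_le_cof_ord h0
  let Large : Set B := {x | ∀ m < l, ∃ A ⊆ Iic x, IsAntichain (· ≤ ·) A ∧ m ≤ #A}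
  have hIci : ∀ (x : B) (c : Cardinal.{u}),
      (∀ A ⊆ Iic xᶜ, IsAntichain (· ≤ ·) A → #A ≤ c) →
      ∀ A ⊆ Ici x, IsAntichain (· ≤ ·) A → #A ≤ c := by
    intro x c h A hAx hA
    rw [← mk_image_eq (s := A) (compl_injective (α := B))]
    refine h _ ?_ hA.image_compl
    rintro _ ⟨a, ha, rfl⟩
    exact compl_le_compl (hAx ha)
  have hsmall : ∀ x, x ∉ Large → ∃ c < l, ∀ A ⊆ Iic x, IsAntichain (· ≤ ·) A → #A ≤ c := by
    intro x hx
    simp only [Large, mem_ofPred_eq] at hx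
    push Not at hx
    obtain ⟨c, hc, h⟩ := hx
    exact ⟨c, hc, fun A hAx hA => (h A hAx hA).le⟩
  have hlarge : ∀ x, xᶜ ∈ Large → ∀ A ⊆ Iic x, IsAntichain (· ≤ ·) A → #A ≤ l.ord.cof := by
    intro x hx A hAx hA
    by_contra! h
    exact hno (hA.exists_of_Iic_compl h0 hl hAx h.le hx)
  have hcover : ∀ m < l, ∃ A ⊆ (Largeᶜ ∩ {x | xᶜ ∉ Large}) ∪ ({x | xᶜ ∈ Large} ∪ Large),
      IsAntichain (· ≤ ·) A ∧ m ≤ #A := by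
    intro m hm
    obtain ⟨A, hA, hmA⟩ := hB m hm
    refine ⟨A, fun x _ => ?_, hA, hmA⟩
    by_cases h₁ : x ∈ Large
    · exact .inr (.inr h₁)
    by_cases h₂ : xᶜ ∈ Large
    · exact .inr (.inl h₂)
    · exact .inl ⟨h₁, h₂⟩
  rcases IsAntichain.exists_of_singular_of_union h0 hl hcover with h | h
  · obtain ⟨P, hPQ, hP, hPS⟩ := IsAntichain.exists_subset_mk_inter_le h
    refine hno (IsAntichain.exists_of_singular h0 hl (P := P)
      (N := fun x => P ∩ Iic x ∪ P ∩ Ici x) (F := fun _ => ∅) (fun x hx => ?_) (by simp)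
      (fun x _ y hy hxy => .inl (hxy.elim (fun h => .inr ⟨hy, h⟩) fun h => .inl ⟨hy, h⟩)) hP)
    obtain ⟨c, hc, hxc⟩ := hsmall x (hPQ hx).1
    obtain ⟨c', hc', hxc'⟩ := hsmall xᶜ (hPQ hx).2
    exact (mk_union_le _ _).trans_lt (add_lt_of_lt h0
      ((hPS _ c hxc).trans_lt (mul_lt_of_lt h0 hl hc))
      ((hPS _ c' (hIci x c' hxc')).trans_lt (mul_lt_of_lt h0 hl hc')))
  rcases IsAntichain.exists_of_singular_of_union h0 hl h with h | h
  · obtain ⟨P, hPQ, hP, hPS⟩ := IsAntichain.exists_subset_mk_inter_le h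
    have hF : ∀ x ∈ P, #(P ∩ Iic x : Set B) ≤ l.ord.cof := fun x hx =>
      (hPS _ _ (hlarge x (hPQ hx))).trans (mul_eq_self hω).le
    exact hno (IsAntichain.exists_of_singular h0 hl (N := fun x => P ∩ Iic x)
      (fun x hx => (hF x hx).trans_lt hl) hF
      (fun x hx y hy hxy => hxy.elim (fun h => .inr ⟨hx, h⟩) fun h => .inl ⟨hy, h⟩) hP)
  · obtain ⟨P, hPQ, hP, hPS⟩ := IsAntichain.exists_subset_mk_inter_le h
    have hF : ∀ x ∈ P, #(P ∩ Ici x : Set B) ≤ l.ord.cof := fun x hx =>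
      (hPS _ _ (hIci x _ (hlarge xᶜ (by rw [compl_compl]; exact hPQ hx)))).trans
        (mul_eq_self hω).le
    exact hno (IsAntichain.exists_of_singular h0 hl (N := fun x => P ∩ Ici x)
      (fun x hx => (hF x hx).trans_lt hl) hF
      (fun x hx y hy hxy => hxy.elim (fun h => .inl ⟨hy, h⟩) fun h => .inr ⟨hx, h⟩) hP)

/-- For an infinite Boolean algebra `B`,
`w⁺(B) = sup {|A|⁺ : A an antichain of B}` is an uncountable regular
cardinal. -/
theorem stmt_16 {B : Type u} [BooleanAlgebra B] [Infinite B]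
    (wplus : Cardinal.{u})
    (hw : wplus = ⨆ A : {A : Set B // IsAntichain (· ≤ ·) A},
      Order.succ (Cardinal.mk A.1)) :
    Cardinal.aleph0 < wplus ∧ wplus.IsRegular := by
  have hlt : ∀ A : Set B, IsAntichain (· ≤ ·) A → #A < wplus := by
    intro A hA
    rw [hw, ← succ_le_iff]
    exact le_ciSup (f := fun A : {A : Set B // IsAntichain (· ≤ ·) A} => succ #A.1)
      (bddAbove_of_small) ⟨A, hA⟩
  have hex : ∀ m < wplus, ∃ A : Set B, IsAntichain (· ≤ ·) A ∧ m ≤ #A := by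
    intro m hm
    rw [hw] at hm
    obtain ⟨A, hA⟩ := exists_lt_of_lt_ciSup' hm
    exact ⟨A.1, A.2, lt_succ_iff.1 hA⟩
  obtain ⟨A, hA, hωA⟩ := exists_infinite_antichain B
  have hω : ℵ₀ < wplus := hωA.trans_lt (hlt A hA)
  refine ⟨hω, hω.le, ?_⟩
  by_contra! hcof
  obtain ⟨C, hC, hle⟩ := BooleanAlgebra.exists_antichain_of_singular hω.le hcof hex
  exact (hlt C hC).not_ge hle
end
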